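/- arXiv:2311.08366 — 3 statements merged into one kernel-verified Lean document; each statement's English description precedes it below -/
import Mathlib

section
/- Fix natural numbers n, m, p and let φ be the (n+p)×(n+m) real block matrix with the n×n identity in the top-left block and zeros elsewhere. Let Q : [0,1] → Mat_{(n+m)×(n+p)}(ℝ) be continuous, and assume the top-left n×n block of Q(t) is zero for every t. Suppose H : [0,1] → Mat_{(n+m)×(n+p)}(ℝ) is differentiable with H(0) = 0 and H′(t) = (1 + H(t)·φ)·Q(t) for all t ∈ [0,1]. Then for every t ∈ [0,1], H(t) = Ω(t) + (1/2)·Ω(t)·φ·Ω(t), where Ω(t) := ∫₀ᵗ Q(u) du + (1/2)·∫₀ᵗ (∫₀ᵘ (Q(v)·φ·Q(u) − Q(u)·φ·Q(v)) dv) du; equivalently, since the top-left n×n block of Ω(t) vanishes, H(t) = exp_*(Ω(t)) and the Magnus expansion terminates after two terms. -/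
open scoped Matrix

/-- The structural matrix `φ : Mat_{(n+p)×(n+m)}(ℝ)` with the `n×n` identity in the
top-left block and zeros elsewhere. -/
noncomputable def structPhi (n m p : ℕ) : Matrix (Fin n ⊕ Fin p) (Fin n ⊕ Fin m) ℝ :=
  Matrix.fromBlocks 1 0 0 0

/-- The `∗`-exponential `exp_*(Z) := ∑_{k=1}^∞ Z·(φ·Z)^{k-1}/k!`
(here reindexed as a sum over `k : ℕ` of `Z·(φ·Z)^k/(k+1)!`). -/
noncomputable def starExp (n m p : ℕ)
    (Z : Matrix (Fin n ⊕ Fin m) (Fin n ⊕ Fin p) ℝ) :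
    Matrix (Fin n ⊕ Fin m) (Fin n ⊕ Fin p) ℝ :=
  ∑' k : ℕ, ((Nat.factorial (k + 1) : ℝ))⁻¹ • (Z * (structPhi n m p * Z) ^ k)

/-- The two-term Magnus expansion
`Ω(t) = ∫₀ᵗ Q(u) du + (1/2)·∫₀ᵗ ∫₀ᵘ (Q(v)·φ·Q(u) − Q(u)·φ·Q(v)) dv du`,
with all integrals taken entrywise. -/
noncomputable def magnusTwo (n m p : ℕ)
    (Q : ℝ → Matrix (Fin n ⊕ Fin m) (Fin n ⊕ Fin p) ℝ) (t : ℝ) :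
    Matrix (Fin n ⊕ Fin m) (Fin n ⊕ Fin p) ℝ :=
  Matrix.of (fun i j =>
    (∫ u in (0:ℝ)..t, Q u i j) +
      (1 / 2) * ∫ u in (0:ℝ)..t,
        (∫ v in (0:ℝ)..u,
          (Q v * structPhi n m p * Q u - Q u * structPhi n m p * Q v) i j))

theorem mul_structPhi_mul_apply {n m p : ℕ} (A B : Matrix (Fin n ⊕ Fin m) (Fin n ⊕ Fin p) ℝ)
    (i : Fin n ⊕ Fin m) (j : Fin n ⊕ Fin p) :
    (A * structPhi n m p * B) i j = ∑ k : Fin n, A i (Sum.inl k) * B (Sum.inl k) j := by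
  simp [Matrix.mul_apply, structPhi, Fintype.sum_sum_type, Matrix.one_apply]

theorem eq_on_Icc_of_hasDerivWithinAt {f g f' : ℝ → ℝ}
    (hf : ∀ t ∈ Set.Icc (0:ℝ) 1, HasDerivWithinAt f (f' t) (Set.Icc 0 1) t)
    (hg : ∀ t ∈ Set.Icc (0:ℝ) 1, HasDerivWithinAt g (f' t) (Set.Icc 0 1) t)
    (h0 : f 0 = g 0) : ∀ t ∈ Set.Icc (0:ℝ) 1, f t = g t := by
  intro t ht
  have h := (convex_Icc (0:ℝ) 1).norm_image_sub_le_of_norm_hasDerivWithin_le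
    (f := fun x => f x - g x) (f' := fun _ => 0) (C := 0)
    (fun x hx => by simpa using (hf x hx).fun_sub (hg x hx)) (by simp)
    (Set.left_mem_Icc.2 zero_le_one) ht
  have h' : f t - g t - (f 0 - g 0) = 0 := by simpa using h
  linarith

theorem starExp_of_block_eq_zero {n m p : ℕ} (Z : Matrix (Fin n ⊕ Fin m) (Fin n ⊕ Fin p) ℝ)
    (hZ : ∀ i j : Fin n, Z (Sum.inl i) (Sum.inl j) = 0) :
    starExp n m p Z = Z + (1 / 2 : ℝ) • (Z * structPhi n m p * Z) := by
  have hZ3 : Z * structPhi n m p * Z * structPhi n m p * Z = 0 := by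
    ext i j
    simp [mul_structPhi_mul_apply, hZ]
  have hpow (k : ℕ) : Z * (structPhi n m p * Z) ^ (k + 2) = 0 := by
    rw [add_comm, pow_add, pow_two, ← Matrix.mul_assoc, ← Matrix.mul_assoc, ← Matrix.mul_assoc,
      ← Matrix.mul_assoc, hZ3, Matrix.zero_mul]
  rw [starExp, tsum_eq_sum (s := Finset.range 2)]
  · simp [Finset.sum_range_succ, Matrix.mul_assoc]
  · intro k hk
    obtain ⟨l, rfl⟩ := Nat.exists_eq_add_of_le' (not_lt.1 (Finset.mem_range.not.1 hk))
    rw [hpow, smul_zero]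

theorem magnusTwo_congr {n m p : ℕ} {Q R : ℝ → Matrix (Fin n ⊕ Fin m) (Fin n ⊕ Fin p) ℝ}
    (h : Set.EqOn Q R (Set.Icc 0 1)) :
    Set.EqOn (magnusTwo n m p Q) (magnusTwo n m p R) (Set.Icc 0 1) := by
  intro t ht
  have hmem {s u : ℝ} (hs : s ∈ Set.Icc (0:ℝ) 1) (hu : u ∈ Set.uIcc 0 s) :
      u ∈ Set.Icc (0:ℝ) 1 := by
    rw [Set.uIcc_of_le hs.1] at hu
    exact ⟨hu.1, hu.2.trans hs.2⟩
  ext i j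
  simp only [magnusTwo, Matrix.of_apply]
  congr 1
  · exact intervalIntegral.integral_congr fun u hu => by simp only [h (hmem ht hu)]
  · congr 1
    refine intervalIntegral.integral_congr fun u hu => ?_
    refine intervalIntegral.integral_congr fun v hv => ?_
    simp only [h (hmem ht hu), h (hmem (hmem ht hu) hv)]

theorem magnusTwo_apply {n m p : ℕ} {Q : ℝ → Matrix (Fin n ⊕ Fin m) (Fin n ⊕ Fin p) ℝ}
    (hQ : Continuous Q) (t : ℝ) (i : Fin n ⊕ Fin m) (j : Fin n ⊕ Fin p) :
    magnusTwo n m p Q t i j = (∫ u in (0:ℝ)..t, Q u i j) +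
      (1 / 2) * ∫ u in (0:ℝ)..t, ∑ k : Fin n,
        ((∫ v in (0:ℝ)..u, Q v i (Sum.inl k)) * Q u (Sum.inl k) j -
          Q u i (Sum.inl k) * ∫ v in (0:ℝ)..u, Q v (Sum.inl k) j) := by
  have hq (i j) : Continuous fun u => Q u i j := hQ.matrix_elem i j
  simp only [magnusTwo, Matrix.of_apply, Matrix.sub_apply, mul_structPhi_mul_apply,
    ← Finset.sum_sub_distrib]
  congr 3
  ext u
  rw [intervalIntegral.integral_finsetSum]
  · refine Finset.sum_congr rfl fun k _ => ?_
    rw [intervalIntegral.integral_sub, intervalIntegral.integral_mul_const,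
      intervalIntegral.integral_const_mul]
    · exact ((hq _ _).mul continuous_const).intervalIntegrable _ _
    · exact (continuous_const.mul (hq _ _)).intervalIntegrable _ _
  · intro k _
    exact (((hq _ _).mul continuous_const).sub
      (continuous_const.mul (hq _ _))).intervalIntegrable _ _

theorem magnusTwo_terminates_of_continuous
    {n m p : ℕ} {Q H : ℝ → Matrix (Fin n ⊕ Fin m) (Fin n ⊕ Fin p) ℝ}
    (hQ : Continuous Q) (hQblock : ∀ t, ∀ i j : Fin n, Q t (Sum.inl i) (Sum.inl j) = 0)
    (hH0 : H 0 = 0)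
    (hH : ∀ t ∈ Set.Icc (0:ℝ) 1, ∀ (i : Fin n ⊕ Fin m) (j : Fin n ⊕ Fin p),
      HasDerivWithinAt (fun u => H u i j)
        (((1 + H t * structPhi n m p) * Q t :
          Matrix (Fin n ⊕ Fin m) (Fin n ⊕ Fin p) ℝ) i j) (Set.Icc (0:ℝ) 1) t) :
    ∀ t ∈ Set.Icc (0:ℝ) 1,
      H t = magnusTwo n m p Q t +
          (1 / 2 : ℝ) • (magnusTwo n m p Q t * structPhi n m p * magnusTwo n m p Q t) ∧
      H t = starExp n m p (magnusTwo n m p Q t) := by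
  have hq (i j) : Continuous fun u => Q u i j := hQ.matrix_elem i j
  set P : (Fin n ⊕ Fin m) → (Fin n ⊕ Fin p) → ℝ → ℝ := fun i j t => ∫ u in (0:ℝ)..t, Q u i j
    with hP
  have hPderiv (i j t) : HasDerivAt (P i j) (Q t i j) t :=
    ((hq i j).integral_hasStrictDerivAt 0 t).hasDerivAt
  have hPcont (i j) : Continuous (P i j) :=
    continuous_iff_continuousAt.2 fun t => (hPderiv i j t).continuousAt
  have hPblock (i j : Fin n) (t) : P (Sum.inl i) (Sum.inl j) t = 0 := by simp [hP, hQblock]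
  have hΩ (t i j) : magnusTwo n m p Q t i j = P i j t + (1 / 2) * ∫ u in (0:ℝ)..t,
      ∑ k : Fin n, (P i (Sum.inl k) u * Q u (Sum.inl k) j -
        Q u i (Sum.inl k) * P (Sum.inl k) j u) := magnusTwo_apply hQ t i j
  have hΩcol (t i) (k : Fin n) : magnusTwo n m p Q t i (Sum.inl k) = P i (Sum.inl k) t := by
    simp [hΩ, hQblock, hPblock]
  have hΩrow (t j) (k : Fin n) : magnusTwo n m p Q t (Sum.inl k) j = P (Sum.inl k) j t := by
    simp [hΩ, hQblock, hPblock]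
  have hH' : ∀ t ∈ Set.Icc (0:ℝ) 1, ∀ i j, HasDerivWithinAt (fun u => H u i j)
      (Q t i j + ∑ k : Fin n, H t i (Sum.inl k) * Q t (Sum.inl k) j) (Set.Icc 0 1) t := by
    intro t ht i j
    have h := hH t ht i j
    rwa [Matrix.add_mul, Matrix.one_mul, Matrix.add_apply, mul_structPhi_mul_apply] at h
  have hHcol (i) (k : Fin n) : ∀ t ∈ Set.Icc (0:ℝ) 1, H t i (Sum.inl k) = P i (Sum.inl k) t :=
    eq_on_Icc_of_hasDerivWithinAt
      (fun t ht => by simpa [hQblock] using hH' t ht i (Sum.inl k))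
      (fun t _ => (hPderiv i (Sum.inl k) t).hasDerivWithinAt) (by simp [hH0, hP])
  have key : ∀ t ∈ Set.Icc (0:ℝ) 1, H t = magnusTwo n m p Q t +
      (1 / 2 : ℝ) • (magnusTwo n m p Q t * structPhi n m p * magnusTwo n m p Q t) := by
    intro t ht
    ext i j
    simp only [Matrix.add_apply, Matrix.smul_apply, mul_structPhi_mul_apply, hΩcol, hΩrow,
      smul_eq_mul, hΩ]
    refine eq_on_Icc_of_hasDerivWithinAt (f := fun t => H t i j)
      (g := fun t => P i j t + (1 / 2) * (∫ u in (0:ℝ)..t,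
        ∑ k : Fin n, (P i (Sum.inl k) u * Q u (Sum.inl k) j -
          Q u i (Sum.inl k) * P (Sum.inl k) j u)) +
        (1 / 2) * ∑ k : Fin n, P i (Sum.inl k) t * P (Sum.inl k) j t)
      (f' := fun t => Q t i j + ∑ k : Fin n, P i (Sum.inl k) t * Q t (Sum.inl k) j)
      (fun s hs => ?_) (fun s _ => ?_) ?_ t ht
    · simpa only [hHcol i _ s hs] using hH' s hs i j
    · have hint : Continuous fun u => ∑ k : Fin n, (P i (Sum.inl k) u * Q u (Sum.inl k) j -
          Q u i (Sum.inl k) * P (Sum.inl k) j u) :=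
        continuous_finsetSum _ fun k _ =>
          ((hPcont _ _).mul (hq _ _)).sub ((hq _ _).mul (hPcont _ _))
      have hd := ((hPderiv i j s).fun_add
        ((hint.integral_hasStrictDerivAt 0 s).hasDerivAt.const_mul (1 / 2))).fun_add
        ((HasDerivAt.fun_sum (u := Finset.univ) fun (k : Fin n) _ =>
          (hPderiv i (Sum.inl k) s).fun_mul (hPderiv (Sum.inl k) j s)).const_mul (1 / 2))
      refine (hd.congr_deriv ?_).hasDerivWithinAt
      rw [Finset.sum_sub_distrib, Finset.sum_add_distrib]
      ring
    · simp [hH0, hP]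
  intro t ht
  refine ⟨key t ht, ?_⟩
  rw [starExp_of_block_eq_zero _ fun i j => by rw [hΩcol, hPblock]]
  exact key t ht

/-- If `Q : [0,1] → Mat_{(n+m)×(n+p)}(ℝ)` is continuous with vanishing
top-left `n×n` block and `H` solves `H′(t) = (1 + H(t)·φ)·Q(t)`, `H(0) = 0`, on `[0,1]`,
then `H(t) = Ω(t) + (1/2)·Ω(t)·φ·Ω(t)` where `Ω` is the two-term Magnus expansion;
equivalently `H(t) = exp_*(Ω(t))`: the Magnus expansion terminates after two terms. -/
theorem magnus_expansion_terminates
    (n m p : ℕ) (Q H : ℝ → Matrix (Fin n ⊕ Fin m) (Fin n ⊕ Fin p) ℝ)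
    (hQcont : ContinuousOn Q (Set.Icc 0 1))
    (hQblock : ∀ t ∈ Set.Icc (0:ℝ) 1, ∀ (i j : Fin n), Q t (Sum.inl i) (Sum.inl j) = 0)
    (hH0 : H 0 = 0)
    (hH : ∀ t ∈ Set.Icc (0:ℝ) 1, ∀ (i : Fin n ⊕ Fin m) (j : Fin n ⊕ Fin p),
      HasDerivWithinAt (fun u => H u i j)
        ((((1 + H t * structPhi n m p) * Q t :
          Matrix (Fin n ⊕ Fin m) (Fin n ⊕ Fin p) ℝ)) i j) (Set.Icc (0:ℝ) 1) t) :
    ∀ t ∈ Set.Icc (0:ℝ) 1,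
      H t = magnusTwo n m p Q t +
          (1 / 2 : ℝ) • (magnusTwo n m p Q t * structPhi n m p * magnusTwo n m p Q t) ∧
      H t = starExp n m p (magnusTwo n m p Q t) := by
  set R : ℝ → Matrix (Fin n ⊕ Fin m) (Fin n ⊕ Fin p) ℝ :=
    Set.IccExtend zero_le_one ((Set.Icc (0:ℝ) 1).domRestrict Q) with hR
  have hQR : Set.EqOn Q R (Set.Icc 0 1) := fun t ht => by
    rw [hR, Set.IccExtend_of_mem _ _ ht, Set.domRestrict_apply]
  have hRcont : Continuous R := hQcont.domRestrict.Icc_extend'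
  have hRblock (t) (i j : Fin n) : R t (Sum.inl i) (Sum.inl j) = 0 :=
    hQblock _ (Set.projIcc (0:ℝ) 1 zero_le_one t).2 i j
  intro t ht
  rw [magnusTwo_congr hQR ht]
  exact magnusTwo_terminates_of_continuous hRcont hRblock hH0
    (fun s hs i j => by rw [← hQR hs]; exact hH s hs i j) t ht
end

section
/- Let 1 ≤ p < 2 and v > 0. There exists a constant C > 0, depending only on p and v, with the following property. Let x : [0,1] → ℝ^d be continuously differentiable, let V : ℝ^e → L(ℝ^d, ℝ^e) be Lipschitz with Lipschitz constant at most v (in the operator norm) and satisfy ‖V(a)‖_op ≤ v·(1 + ‖a‖) for all a ∈ ℝ^e, and let y : [0,1] → ℝ^e be differentiable with y′(t) = V(y(t))(x′(t)) for all t ∈ [0,1]. Then for all 0 ≤ s < s' ≤ 1: |y|_{p;[s,s']} ≤ (‖y(s)‖ + C·|x|_{p;[0,1]})·exp(C·|x|^p_{p;[s,s']}). -/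
open scoped ENNReal

/-- The `p`-th power of the 1D `p`-variation of `x : ℝ → E` over `[s,s']`:
the supremum, over all finite monotone partitions `s = r₀ ≤ r₁ ≤ ... ≤ r_k = s'`, of
`∑ᵢ ‖x(rᵢ₊₁) − x(rᵢ)‖^p`, valued in `ℝ≥0∞`. -/
noncomputable def oneVarPow {E : Type*} [NormedAddCommGroup E]
    (p : ℝ) (x : ℝ → E) (s s' : ℝ) : ℝ≥0∞ :=
  ⨆ (k : ℕ) (r : Fin (k + 1) → ℝ) (_ : Monotone r) (_ : r 0 = s) (_ : r (Fin.last k) = s'),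
    ∑ i : Fin k, (‖x (r i.succ) - x (r i.castSucc)‖₊ : ℝ≥0∞) ^ p

/-- The 1D `p`-variation `|x|_{p;[s,s']}`, i.e. the `1/p`-th power of `oneVarPow`. -/
noncomputable def oneVar {E : Type*} [NormedAddCommGroup E]
    (p : ℝ) (x : ℝ → E) (s s' : ℝ) : ℝ≥0∞ :=
  oneVarPow p x s s' ^ (1 / p)

open Set Filter Topology

section Variation

variable {E : Type*} [NormedAddCommGroup E] {p : ℝ} {x : ℝ → E} {s t u : ℝ}

/-- Partition sums along an `ℕ`-indexed monotone sequence are bounded by the `p`-variation. -/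
lemma sum_range_le_oneVarPow (r : ℕ → ℝ) (hr : Monotone r) (k : ℕ) :
    ∑ i ∈ Finset.range k, (‖x (r (i + 1)) - x (r i)‖₊ : ℝ≥0∞) ^ p ≤
      oneVarPow p x (r 0) (r k) := by
  have hmono : Monotone fun i : Fin (k + 1) => r i := fun i j hij => hr hij
  refine le_trans (le_of_eq ?_) (le_iSup_of_le k <| le_iSup_of_le (fun i => r i) <|
    le_iSup_of_le hmono <| le_iSup_of_le (by simp) <| le_iSup_of_le (by simp) le_rfl)
  rw [← Fin.sum_univ_eq_sum_range]
  simp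

/-- To bound the `p`-variation it is enough to bound the partition sums along
`ℕ`-indexed monotone sequences. -/
lemma oneVarPow_le {B : ℝ≥0∞}
    (h : ∀ (k : ℕ) (r : ℕ → ℝ), Monotone r → r 0 = s → r k = t →
      ∑ i ∈ Finset.range k, (‖x (r (i + 1)) - x (r i)‖₊ : ℝ≥0∞) ^ p ≤ B) :
    oneVarPow p x s t ≤ B := by
  refine iSup_le fun k => iSup_le fun r => iSup_le fun hr => iSup_le fun h0 => iSup_le fun hk => ?_
  let r' : ℕ → ℝ := fun i => r ⟨min i k, by omega⟩
  have hr' : Monotone r' := fun i j hij => hr (by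
    simp only [Fin.mk_le_mk]
    omega)
  refine le_trans (le_of_eq ?_) (h k r' hr' ?_ ?_)
  · rw [← Fin.sum_univ_eq_sum_range]
    refine Finset.sum_congr rfl fun i _ => ?_
    have h1 : r' ((i : ℕ) + 1) = r i.succ := congrArg r (Fin.ext (by
      simp only [Fin.val_succ]
      omega))
    have h2 : r' (i : ℕ) = r i.castSucc := congrArg r (Fin.ext (by
      simp only [Fin.val_castSucc]
      omega))
    rw [h1, h2]
  · rw [← h0]
    exact congrArg r (Fin.ext (by simp))
  · rw [← hk]
    exact congrArg r (Fin.ext (by simp))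

lemma exists_monotone_seq_of_le (hst : s ≤ t) :
    ∃ r : ℕ → ℝ, Monotone r ∧ r 0 = s ∧ r 1 = t :=
  ⟨fun i => if i = 0 then s else t, monotone_nat_of_le_succ fun n => by
    rcases n with _ | n <;> simp [hst], by simp, by simp⟩

lemma nnnorm_sub_rpow_le_oneVarPow (hst : s ≤ t) :
    (‖x t - x s‖₊ : ℝ≥0∞) ^ p ≤ oneVarPow p x s t := by
  obtain ⟨r, hr, rfl, rfl⟩ := exists_monotone_seq_of_le hst
  simpa using sum_range_le_oneVarPow (p := p) (x := x) r hr 1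

lemma oneVarPow_add_le (p : ℝ) (x : ℝ → E) (hsu : s ≤ u) (hut : u ≤ t) :
    oneVarPow p x s u + oneVarPow p x u t ≤ oneVarPow p x s t := by
  have key : ∀ (k : ℕ) (r : ℕ → ℝ), Monotone r → r 0 = s → r k = u →
      ∀ (l : ℕ) (q : ℕ → ℝ), Monotone q → q 0 = u → q l = t →
      ∑ i ∈ Finset.range k, (‖x (r (i + 1)) - x (r i)‖₊ : ℝ≥0∞) ^ p +
        ∑ i ∈ Finset.range l, (‖x (q (i + 1)) - x (q i)‖₊ : ℝ≥0∞) ^ p ≤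
        oneVarPow p x s t := by
    intro k r hr hr0 hrk l q hq hq0 hql
    let z : ℕ → ℝ := fun i => if i ≤ k then r i else q (i - k)
    have hz1 : ∀ i, i ≤ k → z i = r i := fun i hi => if_pos hi
    have hz2 : ∀ i, z (k + i) = q i := by
      intro i
      rcases i with _ | i
      · simp [z, hrk, hq0]
      · simp [z]
    have hz : Monotone z := by
      refine monotone_nat_of_le_succ fun n => ?_
      rcases lt_or_ge n k with h | h
      · rw [hz1 n h.le, hz1 (n + 1) h]
        exact hr (Nat.le_succ n)
      · obtain ⟨m, rfl⟩ := Nat.exists_eq_add_of_le h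
        rw [hz2, add_assoc, hz2]
        exact hq (Nat.le_succ m)
    have := sum_range_le_oneVarPow (p := p) (x := x) z hz (k + l)
    rw [Finset.sum_range_add, hz1 0 (Nat.zero_le _), hz2, hr0, hql] at this
    refine le_trans (le_of_eq ?_) this
    congr 1
    · refine Finset.sum_congr rfl fun i hi => ?_
      have hi := Finset.mem_range.1 hi
      rw [hz1 i hi.le, hz1 (i + 1) hi]
    · refine Finset.sum_congr rfl fun i _ => ?_
      rw [add_assoc, hz2, hz2]
  rcases eq_or_ne (oneVarPow p x s t) ⊤ with htop | htop
  · exact htop ▸ le_top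
  obtain ⟨r, hr, hr0, hr1⟩ := exists_monotone_seq_of_le hsu
  obtain ⟨q, hq, hq0, hq1⟩ := exists_monotone_seq_of_le hut
  have hsub : ∀ (l : ℕ) (q : ℕ → ℝ), Monotone q → q 0 = u → q l = t →
      oneVarPow p x s u ≤ oneVarPow p x s t -
        ∑ i ∈ Finset.range l, (‖x (q (i + 1)) - x (q i)‖₊ : ℝ≥0∞) ^ p := by
    intro l q hq hq0 hql
    refine oneVarPow_le fun k r hr hr0 hrk => ?_
    have h := key k r hr hr0 hrk l q hq hq0 hql
    exact ENNReal.le_sub_of_add_le_right (ne_top_of_le_ne_top htop (le_add_self.trans h)) h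
  have hle : oneVarPow p x s u ≤ oneVarPow p x s t := (hsub 1 q hq hq0 hq1).trans tsub_le_self
  refine add_le_of_le_tsub_left_of_le hle (oneVarPow_le fun l q hq hq0 hql => ?_)
  have hT := le_add_self.trans (key 1 r hr hr0 hr1 l q hq hq0 hql)
  refine ENNReal.le_sub_of_add_le_left (ne_top_of_le_ne_top htop hle) ?_
  exact add_le_of_le_tsub_right_of_le hT (hsub l q hq hq0 hql)

/-- Superadditive functions of intervals bounding the `p`-th powers of the increments bound
the `p`-variation. -/
lemma oneVarPow_le_of_superadditive {W : ℝ → ℝ → ℝ≥0∞}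
    (hW : ∀ a b c, s ≤ a → a ≤ b → b ≤ c → c ≤ t → W a b + W b c ≤ W a c)
    (hx : ∀ a b, s ≤ a → a ≤ b → b ≤ t → (‖x b - x a‖₊ : ℝ≥0∞) ^ p ≤ W a b) :
    oneVarPow p x s t ≤ W s t := by
  refine oneVarPow_le fun k r hr hr0 hrk => ?_
  have key : ∀ j, j ≤ k →
      ∑ i ∈ Finset.range j, (‖x (r (i + 1)) - x (r i)‖₊ : ℝ≥0∞) ^ p ≤ W (r 0) (r j) := by
    intro j
    induction j with
    | zero => simp
    | succ j ih =>
      intro hj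
      have h0 : s ≤ r j := hr0 ▸ hr (Nat.zero_le j)
      have h1 : r (j + 1) ≤ t := hrk ▸ hr hj
      have h2 : r j ≤ r (j + 1) := hr (Nat.le_succ j)
      rw [Finset.sum_range_succ]
      exact (add_le_add (ih (by omega)) (hx _ _ h0 h2 h1)).trans
        (hW _ _ _ hr0.ge (hr (Nat.zero_le j)) h2 h1)
  simpa [hr0, hrk] using key k le_rfl

lemma oneVarPow_eq_oneVar_rpow (hp : 0 < p) (x : ℝ → E) (s t : ℝ) :
    oneVarPow p x s t = oneVar p x s t ^ p := by
  rw [oneVar, ← ENNReal.rpow_mul, one_div_mul_cancel hp.ne', ENNReal.rpow_one]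

lemma oneVar_le_add (hp : 1 ≤ p) (x : ℝ → E) (hsu : s ≤ u) (hut : u ≤ t) :
    oneVar p x s t ≤ oneVar p x s u + oneVar p x u t := by
  have hp0 : 0 < p := by linarith
  refine (ENNReal.rpow_le_rpow_iff hp0).1 ?_
  rw [← oneVarPow_eq_oneVar_rpow hp0]
  refine oneVarPow_le fun k r hr hr0 hrk => ?_
  have hmin : Monotone fun i => min (r i) u := fun i j hij => min_le_min_right _ (hr hij)
  have hmax : Monotone fun i => max (r i) u := fun i j hij => max_le_max_right _ (hr hij)
  have h1 := sum_range_le_oneVarPow (p := p) (x := x) _ hmin k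
  have h2 := sum_range_le_oneVarPow (p := p) (x := x) _ hmax k
  simp only [hr0, hrk, min_eq_left hsu, min_eq_right hut, max_eq_right hsu, max_eq_left hut]
    at h1 h2
  refine (ENNReal.rpow_le_rpow_iff (one_div_pos.2 hp0)).1 ?_
  rw [← ENNReal.rpow_mul (oneVar p x s u + oneVar p x u t), mul_one_div_cancel hp0.ne',
    ENNReal.rpow_one]
  refine le_trans ?_ (add_le_add (ENNReal.rpow_le_rpow h1 (one_div_pos.2 hp0).le)
    (ENNReal.rpow_le_rpow h2 (one_div_pos.2 hp0).le))
  refine le_trans ?_ (ENNReal.Lp_add_le _ _ _ hp)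
  refine ENNReal.rpow_le_rpow (Finset.sum_le_sum fun i _ => ENNReal.rpow_le_rpow ?_ hp0.le)
    (one_div_pos.2 hp0).le
  have hsplit : ∀ c, x c = x (min c u) + x (max c u) - x u := by
    intro c
    rcases le_total c u with h | h <;> simp [h]
  have heq : x (r (i + 1)) - x (r i) = (x (min (r (i + 1)) u) - x (min (r i) u)) +
      (x (max (r (i + 1)) u) - x (max (r i) u)) := by
    rw [hsplit (r (i + 1)), hsplit (r i)]
    abel
  rw [heq]
  exact_mod_cast nnnorm_add_le _ _

lemma oneVarPow_le_of_lipschitz (hp : 1 ≤ p) {L : ℝ}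
    (hL : ∀ a b, s ≤ a → a ≤ b → b ≤ t → ‖x b - x a‖ ≤ L * (b - a)) (hst : s ≤ t) :
    oneVarPow p x s t ≤ ENNReal.ofReal (L * (t - s)) ^ p := by
  rcases hst.eq_or_lt with rfl | hlt
  · refine (oneVarPow_le_of_superadditive (W := fun _ _ => 0) (by simp) ?_).trans zero_le
    intro a b ha hab hb
    obtain rfl : b = a := le_antisymm (hb.trans ha) hab
    simp [show 0 < p by linarith]
  have hL0 : 0 ≤ L := by
    have := (norm_nonneg _).trans (hL s t le_rfl hst le_rfl)
    exact nonneg_of_mul_nonneg_left this (sub_pos.2 hlt)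
  refine oneVarPow_le_of_superadditive (W := fun a b => ENNReal.ofReal (L * (b - a)) ^ p) ?_ ?_
  · intro a b c _ hab hbc _
    refine (ENNReal.add_rpow_le_rpow_add _ _ hp).trans ?_
    rw [← ENNReal.ofReal_add (mul_nonneg hL0 (by linarith)) (mul_nonneg hL0 (by linarith))]
    exact le_of_eq (by ring_nf)
  · intro a b ha hab hb
    refine ENNReal.rpow_le_rpow ?_ (by linarith)
    rw [← ENNReal.ofReal_coe_nnreal]
    exact ENNReal.ofReal_le_ofReal (hL a b ha hab hb)

end Variation

/-- A superadditive function of the subintervals of `[a, b]`, continuous in the right endpoint. -/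
structure IsControlOn (ω : ℝ → ℝ → ℝ) (a b : ℝ) : Prop where
  nonneg : ∀ s t, a ≤ s → s ≤ t → t ≤ b → 0 ≤ ω s t
  superadd : ∀ s u t, a ≤ s → s ≤ u → u ≤ t → t ≤ b → ω s u + ω u t ≤ ω s t
  cont : ∀ s t, a ≤ s → s ≤ t → t ≤ b → ContinuousOn (ω s) (Icc s t)

namespace IsControlOn

variable {ω : ℝ → ℝ → ℝ} {a b a' b' s t : ℝ}

lemma subinterval (h : IsControlOn ω a b) (ha : a ≤ a') (hb : b' ≤ b) : IsControlOn ω a' b' where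
  nonneg s t hs hst ht := h.nonneg s t (ha.trans hs) hst (ht.trans hb)
  superadd s u t hs hsu hut ht := h.superadd s u t (ha.trans hs) hsu hut (ht.trans hb)
  cont s t hs hst ht := h.cont s t (ha.trans hs) hst (ht.trans hb)

lemma self_eq_zero (h : IsControlOn ω a b) (ha : a ≤ s) (hb : s ≤ b) : ω s s = 0 := by
  have h1 := h.nonneg s s ha le_rfl hb
  have h2 := h.superadd s s s ha le_rfl le_rfl hb
  linarith

lemma mono (h : IsControlOn ω a b) (ha : a ≤ s) (hst : s ≤ t) (hb : t ≤ b) : ω s t ≤ ω a b := by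
  have h1 := h.superadd a s t le_rfl ha hst hb
  have h2 := h.superadd a t b le_rfl (ha.trans hst) hb le_rfl
  have h3 := h.nonneg a s le_rfl ha (hst.trans hb)
  have h4 := h.nonneg t b (ha.trans hst) hb le_rfl
  linarith

/-- An interval can be cut so that its left part has a prescribed control. -/
lemma exists_split (h : IsControlOn ω a b) (ha : a ≤ s) (hst : s ≤ t) (hb : t ≤ b) {c : ℝ}
    (hc : 0 ≤ c) (hc' : c ≤ ω s t) :
    ∃ u, s ≤ u ∧ u ≤ t ∧ ω s u = c ∧ ω u t ≤ ω s t - c := by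
  have hmem : c ∈ Icc (ω s s) (ω s t) := ⟨(h.self_eq_zero ha (hst.trans hb)).le.trans hc, hc'⟩
  obtain ⟨u, ⟨hu1, hu2⟩, rfl⟩ := intermediate_value_Icc hst (h.cont s t ha hst hb) hmem
  have := h.superadd s u t ha hu1 hu2 hb
  exact ⟨u, hu1, hu2, rfl, by linarith⟩

lemma add_length (h : IsControlOn ω a b) {ε : ℝ} (hε : 0 ≤ ε) :
    IsControlOn (fun s t => ω s t + ε * (t - s)) a b where
  nonneg s t hs hst ht := add_nonneg (h.nonneg s t hs hst ht) (mul_nonneg hε (sub_nonneg.2 hst))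
  superadd s u t hs hsu hut ht := by
    have := h.superadd s u t hs hsu hut ht
    linarith
  cont s t hs hst ht := (h.cont s t hs hst ht).add (by fun_prop)

end IsControlOn

section Variation

variable {E : Type*} [NormedAddCommGroup E] {p : ℝ} {x : ℝ → E} {a b : ℝ}

lemma oneVarPow_ne_top_of_lipschitz (hp : 1 ≤ p) {L : ℝ}
    (hL : ∀ s t, a ≤ s → s ≤ t → t ≤ b → ‖x t - x s‖ ≤ L * (t - s)) (hab : a ≤ b) :
    oneVarPow p x a b ≠ ⊤ :=
  ne_top_of_le_ne_top (ENNReal.rpow_ne_top_of_nonneg (by linarith) ENNReal.ofReal_ne_top)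
    (oneVarPow_le_of_lipschitz hp hL hab)

lemma oneVar_ne_top (hp : 1 ≤ p) (h : oneVarPow p x a b ≠ ⊤) : oneVar p x a b ≠ ⊤ :=
  ENNReal.rpow_ne_top_of_nonneg (by positivity) h

lemma isControlOn_oneVarPow (hp : 1 ≤ p) {L : ℝ}
    (hL : ∀ s t, a ≤ s → s ≤ t → t ≤ b → ‖x t - x s‖ ≤ L * (t - s)) :
    IsControlOn (fun s t => (oneVarPow p x s t).toReal) a b := by
  have hp0 : 0 < p := by linarith
  have hfin : ∀ s t, a ≤ s → s ≤ t → t ≤ b → oneVarPow p x s t ≠ ⊤ := fun s t hs hst ht =>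
    oneVarPow_ne_top_of_lipschitz hp (fun q r hq hqr hr =>
      hL q r (hs.trans hq) hqr (hr.trans ht)) hst
  refine ⟨fun _ _ _ _ _ => ENNReal.toReal_nonneg, fun s u t hs hsu hut ht => ?_,
    fun s t hs hst ht => ?_⟩
  · rw [← ENNReal.toReal_add (hfin s u hs hsu (hut.trans ht)) (hfin u t (hs.trans hsu) hut ht)]
    exact ENNReal.toReal_mono (hfin s t hs (hsu.trans hut) ht) (oneVarPow_add_le p x hsu hut)
  · have hlip : ∀ u r, s ≤ u → u ≤ r → r ≤ t →
        |(oneVar p x s r).toReal - (oneVar p x s u).toReal| ≤ |L| * (r - u) := by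
      intro u r hu hur hr
      have hf1 := oneVar_ne_top hp (hfin s u hs hu (hur.trans (hr.trans ht)))
      have hf2 := oneVar_ne_top hp (hfin s r hs (hu.trans hur) (hr.trans ht))
      have hf3 := oneVar_ne_top hp (hfin u r (hs.trans hu) hur (hr.trans ht))
      have hmono : oneVar p x s u ≤ oneVar p x s r := ENNReal.rpow_le_rpow
        (le_self_add.trans (oneVarPow_add_le p x hu hur)) (by positivity)
      have hadd := ENNReal.toReal_mono (ENNReal.add_ne_top.2 ⟨hf1, hf3⟩) (oneVar_le_add hp x hu hur)
      rw [ENNReal.toReal_add hf1 hf3] at hadd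
      have hur' : (oneVar p x u r).toReal ≤ |L| * (r - u) := by
        have hpow := oneVarPow_le_of_lipschitz (x := x) (L := |L|) hp
          (fun c d hc hcd hd => (hL c d (hs.trans (hu.trans hc)) hcd
            (hd.trans (hr.trans ht))).trans
              (mul_le_mul_of_nonneg_right (le_abs_self L) (sub_nonneg.2 hcd))) hur
        rw [oneVarPow_eq_oneVar_rpow hp0, ENNReal.rpow_le_rpow_iff hp0] at hpow
        exact ENNReal.toReal_le_of_le_ofReal
          (mul_nonneg (abs_nonneg L) (sub_nonneg.2 hur)) hpow
      rw [abs_of_nonneg (sub_nonneg.2 (ENNReal.toReal_mono hf2 hmono))]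
      linarith
    have hcont : ContinuousOn (fun u => (oneVar p x s u).toReal) (Icc s t) := by
      refine (LipschitzOnWith.of_dist_le_mul (K := ‖L‖₊) fun u hu r hr => ?_).continuousOn
      rcases le_total u r with h | h
      · rw [dist_comm, Real.dist_eq, Real.dist_eq, abs_sub_comm u r,
          abs_of_nonneg (sub_nonneg.2 h)]
        exact hlip u r hu.1 h hr.2
      · rw [Real.dist_eq, Real.dist_eq, abs_of_nonneg (sub_nonneg.2 h)]
        exact hlip r u hr.1 h hu.2
    refine (hcont.rpow_const (p := p) fun _ _ => Or.inr hp0.le).congr fun u _ => ?_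
    simp only [oneVarPow_eq_oneVar_rpow hp0, ENNReal.toReal_rpow]

lemma norm_sub_le_rpow_of_oneVarPow_ne_top (hp : 0 < p) (hab : a ≤ b)
    (h : oneVarPow p x a b ≠ ⊤) :
    ‖x b - x a‖ ≤ (oneVarPow p x a b).toReal ^ (1 / p) := by
  have h1 := ENNReal.rpow_le_rpow (nnnorm_sub_rpow_le_oneVarPow (p := p) (x := x) hab)
    (one_div_pos.2 hp).le
  rw [← ENNReal.rpow_mul, mul_one_div_cancel hp.ne', ENNReal.rpow_one] at h1
  have h2 := ENNReal.toReal_mono (ENNReal.rpow_ne_top_of_nonneg (one_div_pos.2 hp).le h) h1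
  rwa [← ENNReal.toReal_rpow, ENNReal.coe_toReal, coe_nnnorm] at h2

end Variation

section Remainder

variable {E F : Type*} [NormedAddCommGroup E] [NormedSpace ℝ E] [NormedAddCommGroup F]
  [NormedSpace ℝ F] {p v l M a b : ℝ} {ω : ℝ → ℝ → ℝ} {x : ℝ → E} {y : ℝ → F} {V : F → E →L[ℝ] F}

/-- One halving of the interval improves a bound on the Euler remainder. -/
lemma remainder_bound_improve (hp : 1 ≤ p) (hv : 0 ≤ v) (hM : 0 ≤ M)
    (hω : IsControlOn ω a b) (hωl : ω a b ^ (1 / p) ≤ l)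
    (hx : ∀ s t, a ≤ s → s ≤ t → t ≤ b → ‖x t - x s‖ ≤ ω s t ^ (1 / p))
    (hV : ∀ c d, ‖V c - V d‖ ≤ v * ‖c - d‖)
    (hVM : ∀ t, a ≤ t → t ≤ b → ‖V (y t)‖ ≤ v * M) {c : ℝ} (hc : 0 ≤ c)
    (hD : ∀ s t, a ≤ s → s ≤ t → t ≤ b →
      ‖y t - y s - V (y s) (x t - x s)‖ ≤ c * (ω s t ^ (1 / p)) ^ 2) :
    ∀ s t, a ≤ s → s ≤ t → t ≤ b → ‖y t - y s - V (y s) (x t - x s)‖ ≤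
      ((2 + v * l) * ((1 / 2) ^ (1 / p)) ^ 2 * c + v ^ 2 * M) * (ω s t ^ (1 / p)) ^ 2 := by
  intro s t hs hst ht
  have hq : 0 ≤ 1 / p := by positivity
  have hω0 := hω.nonneg s t hs hst ht
  obtain ⟨u, hsu, hut, h1, h2⟩ := hω.exists_split hs hst ht (c := ω s t / 2) (by linarith)
    (by linarith)
  set κ : ℝ := (1 / 2) ^ (1 / p) with hκ
  have hκ0 : 0 ≤ κ := by positivity
  have hκ1 : κ ≤ 1 := Real.rpow_le_one (by norm_num) (by norm_num) hq
  set w := ω s t ^ (1 / p) with hw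
  have hw0 : 0 ≤ w := Real.rpow_nonneg hω0 _
  have hwl : w ≤ l := (Real.rpow_le_rpow hω0 (hω.mono hs hst ht) hq).trans hωl
  have hhalf : (ω s t / 2) ^ (1 / p) = κ * w := by
    rw [hκ, hw, ← Real.mul_rpow (by norm_num) hω0]
    ring_nf
  have hwsu : ω s u ^ (1 / p) = κ * w := by rw [h1, hhalf]
  have hwut : ω u t ^ (1 / p) ≤ κ * w := by
    rw [← hhalf]
    exact Real.rpow_le_rpow (hω.nonneg u t (hs.trans hsu) hut ht) (by linarith) hq
  have hwut0 : 0 ≤ ω u t ^ (1 / p) := Real.rpow_nonneg (hω.nonneg u t (hs.trans hsu) hut ht) _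
  have hDsu := hD s u hs hsu (hut.trans ht)
  have hDut := hD u t (hs.trans hsu) hut ht
  have hxsu := hx s u hs hsu (hut.trans ht)
  have hxut := hx u t (hs.trans hsu) hut ht
  rw [hwsu] at hDsu hxsu
  have hDut' : ‖y t - y u - V (y u) (x t - x u)‖ ≤ c * (κ * w) ^ 2 :=
    hDut.trans (mul_le_mul_of_nonneg_left (pow_le_pow_left₀ hwut0 hwut 2) hc)
  have hVs := hVM s hs (hst.trans ht)
  have hy : ‖y u - y s‖ ≤ c * (κ * w) ^ 2 + v * M * (κ * w) := by
    calc ‖y u - y s‖ = ‖(y u - y s - V (y s) (x u - x s)) + V (y s) (x u - x s)‖ := by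
          rw [sub_add_cancel]
      _ ≤ _ := (norm_add_le _ _).trans (add_le_add hDsu
          ((V (y s)).le_of_opNorm_le_of_le hVs hxsu))
  have hcross : ‖(V (y u) - V (y s)) (x t - x u)‖ ≤
      v * (c * (κ * w) ^ 2 + v * M * (κ * w)) * (κ * w) :=
    ContinuousLinearMap.le_of_opNorm_le_of_le _
      ((hV _ _).trans (mul_le_mul_of_nonneg_left hy hv)) (hxut.trans hwut)
  have hdecomp : y t - y s - V (y s) (x t - x s) = (y u - y s - V (y s) (x u - x s)) +
      (y t - y u - V (y u) (x t - x u)) + (V (y u) - V (y s)) (x t - x u) := by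
    simp only [map_sub, sub_apply]
    abel
  rw [hdecomp]
  have hκw : κ * w ≤ l := (mul_le_of_le_one_left hw0 hκ1).trans hwl
  have e1 : v * c * (κ * w) ^ 2 * (κ * w) ≤ v * c * (κ * w) ^ 2 * l :=
    mul_le_mul_of_nonneg_left hκw (by positivity)
  have e2 : v ^ 2 * M * (κ * w) ^ 2 ≤ v ^ 2 * M * w ^ 2 :=
    mul_le_mul_of_nonneg_left (pow_le_pow_left₀ (by positivity)
      (mul_le_of_le_one_left hw0 hκ1) 2) (by positivity)
  calc _ ≤ c * (κ * w) ^ 2 + c * (κ * w) ^ 2 +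
        v * (c * (κ * w) ^ 2 + v * M * (κ * w)) * (κ * w) :=
        (norm_add_le _ _).trans (add_le_add ((norm_add_le _ _).trans
          (add_le_add hDsu hDut')) hcross)
    _ ≤ _ := by linarith

lemma remainder_bound (hp : 1 ≤ p) (hv : 0 ≤ v) (hM : 0 ≤ M) (hl : 0 ≤ l) {ρ : ℝ}
    (hρ : (2 + v * l) * ((1 / 2) ^ (1 / p)) ^ 2 ≤ ρ) (hρ1 : ρ < 1)
    (hω : IsControlOn ω a b) (hωl : ω a b ^ (1 / p) ≤ l)
    (hx : ∀ s t, a ≤ s → s ≤ t → t ≤ b → ‖x t - x s‖ ≤ ω s t ^ (1 / p))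
    (hV : ∀ c d, ‖V c - V d‖ ≤ v * ‖c - d‖)
    (hVM : ∀ t, a ≤ t → t ≤ b → ‖V (y t)‖ ≤ v * M) {c : ℝ} (hc : 0 ≤ c)
    (hD : ∀ s t, a ≤ s → s ≤ t → t ≤ b →
      ‖y t - y s - V (y s) (x t - x s)‖ ≤ c * (ω s t ^ (1 / p)) ^ 2) :
    ∀ s t, a ≤ s → s ≤ t → t ≤ b → ‖y t - y s - V (y s) (x t - x s)‖ ≤
      v ^ 2 / (1 - ρ) * M * (ω s t ^ (1 / p)) ^ 2 := by
  have hρ0 : 0 ≤ ρ := le_trans (by positivity) hρ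
  have h1ρ : 0 < 1 - ρ := sub_pos.2 hρ1
  have key : ∀ n : ℕ, ∀ s t, a ≤ s → s ≤ t → t ≤ b → ‖y t - y s - V (y s) (x t - x s)‖ ≤
      (ρ ^ n * c + v ^ 2 / (1 - ρ) * M) * (ω s t ^ (1 / p)) ^ 2 := by
    intro n
    induction n with
    | zero =>
      intro s t hs hst ht
      refine (hD s t hs hst ht).trans (mul_le_mul_of_nonneg_right ?_ (sq_nonneg _))
      have : 0 ≤ v ^ 2 / (1 - ρ) * M := by positivity
      linarith
    | succ n ih =>
      intro s t hs hst ht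
      have hcn : 0 ≤ ρ ^ n * c + v ^ 2 / (1 - ρ) * M := by positivity
      refine (remainder_bound_improve hp hv hM hω hωl hx hV hVM hcn ih s t hs hst ht).trans
        (mul_le_mul_of_nonneg_right ?_ (sq_nonneg _))
      refine (add_le_add_left (mul_le_mul_of_nonneg_right hρ hcn) _).trans (le_of_eq ?_)
      field_simp
      ring
  intro s t hs hst ht
  have hlim : Tendsto (fun n : ℕ => (ρ ^ n * c + v ^ 2 / (1 - ρ) * M) * (ω s t ^ (1 / p)) ^ 2)
      atTop (𝓝 ((0 * c + v ^ 2 / (1 - ρ) * M) * (ω s t ^ (1 / p)) ^ 2)) :=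
    (((tendsto_pow_atTop_nhds_zero_of_lt_one hρ0 hρ1).mul_const c).add_const _).mul_const _
  rw [zero_mul, zero_add] at hlim
  exact ge_of_tendsto' hlim fun n => key n s t hs hst ht

lemma remainder_bound_of_quadratic (hp : 1 ≤ p) (hv : 0 ≤ v) (hM : 0 ≤ M) (hl : 0 ≤ l) {ρ B : ℝ}
    (hρ : (2 + v * l) * ((1 / 2) ^ (1 / p)) ^ 2 ≤ ρ) (hρ1 : ρ < 1)
    (hω : IsControlOn ω a b) (hωl : ω a b < l ^ p) (hab : b - a ≤ 1)
    (hx : ∀ s t, a ≤ s → s ≤ t → t ≤ b → ‖x t - x s‖ ≤ ω s t ^ (1 / p))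
    (hV : ∀ c d, ‖V c - V d‖ ≤ v * ‖c - d‖)
    (hVM : ∀ t, a ≤ t → t ≤ b → ‖V (y t)‖ ≤ v * M) (hB : 0 ≤ B)
    (hD : ∀ s t, a ≤ s → s ≤ t → t ≤ b →
      ‖y t - y s - V (y s) (x t - x s)‖ ≤ B * (t - s) ^ 2) :
    ∀ s t, a ≤ s → s ≤ t → t ≤ b → ‖y t - y s - V (y s) (x t - x s)‖ ≤
      v ^ 2 / (1 - ρ) * M * (ω s t ^ (1 / p)) ^ 2 := by
  intro s t hs hst ht
  have hp0 : 0 < p := by linarith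
  have hq : 0 < 1 / p := by positivity
  have hlim : Tendsto
      (fun ε : ℝ => v ^ 2 / (1 - ρ) * M * ((ω s t + ε * (t - s)) ^ (1 / p)) ^ 2) (𝓝[>] 0)
      (𝓝 (v ^ 2 / (1 - ρ) * M * ((ω s t + 0 * (t - s)) ^ (1 / p)) ^ 2)) := by
    refine Tendsto.mono_left (Continuous.tendsto ?_ 0) nhdsWithin_le_nhds
    have : Continuous fun ε : ℝ => (ω s t + ε * (t - s)) ^ (1 / p) :=
      Continuous.rpow_const (by fun_prop) fun _ => Or.inr hq.le
    fun_prop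
  rw [zero_mul, add_zero] at hlim
  refine ge_of_tendsto hlim ?_
  filter_upwards [Ioo_mem_nhdsGT (sub_pos.2 hωl)] with ε ⟨hε, hε1⟩
  have hωε := hω.add_length hε.le
  refine remainder_bound hp hv hM hl hρ hρ1 hωε ?_ ?_ hV hVM
    (c := B * ((ε⁻¹) ^ (1 / p)) ^ 2) (by positivity) ?_ s t hs hst ht
  · refine (Real.rpow_le_rpow (hωε.nonneg a b le_rfl (hs.trans (hst.trans ht)) le_rfl)
      (show _ ≤ l ^ p by nlinarith) hq.le).trans (le_of_eq ?_)
    rw [← Real.rpow_mul hl, mul_one_div_cancel hp0.ne', Real.rpow_one]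
  · intro q r haq hqr hrb
    have := mul_nonneg hε.le (sub_nonneg.2 hqr)
    exact (hx q r haq hqr hrb).trans
      (Real.rpow_le_rpow (hω.nonneg q r haq hqr hrb) (by linarith) hq.le)
  · intro q r haq hqr hrb
    have h0 : 0 ≤ r - q := sub_nonneg.2 hqr
    have hω0 := hω.nonneg q r haq hqr hrb
    have h1 : r - q ≤ (r - q) ^ (1 / p) :=
      Real.self_le_rpow_of_le_one h0 (by linarith) ((div_le_one hp0).2 hp)
    have h2 : r - q ≤ ε⁻¹ * (ω q r + ε * (r - q)) := by
      rw [mul_add, inv_mul_cancel_left₀ hε.ne']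
      have : 0 ≤ ε⁻¹ * ω q r := by positivity
      linarith
    have h3 : (r - q) ^ (1 / p) ≤ (ε⁻¹) ^ (1 / p) * (ω q r + ε * (r - q)) ^ (1 / p) := by
      rw [← Real.mul_rpow (by positivity) (hωε.nonneg q r haq hqr hrb)]
      exact Real.rpow_le_rpow h0 h2 hq.le
    calc _ ≤ B * (r - q) ^ 2 := hD q r haq hqr hrb
      _ ≤ B * ((ε⁻¹) ^ (1 / p) * (ω q r + ε * (r - q)) ^ (1 / p)) ^ 2 :=
        mul_le_mul_of_nonneg_left (pow_le_pow_left₀ h0 (h1.trans h3) 2) hB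
      _ = _ := by ring

/-- On an interval where the driving control is small, the increments of the solution are
controlled by those of the driver. -/
lemma increment_bound (hp : 1 ≤ p) (hv : 0 ≤ v) (hl : 0 ≤ l) (hl1 : l ≤ 1) {ρ B : ℝ}
    (hρ : (2 + v * l) * ((1 / 2) ^ (1 / p)) ^ 2 ≤ ρ) (hρ1 : ρ < 1)
    (hlK : (v + v ^ 2 / (1 - ρ)) * l ≤ 1 / 2)
    (hω : IsControlOn ω a b) (hωl : ω a b < l ^ p) (hab : b - a ≤ 1)
    (hx : ∀ s t, a ≤ s → s ≤ t → t ≤ b → ‖x t - x s‖ ≤ ω s t ^ (1 / p))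
    (hV : ∀ c d, ‖V c - V d‖ ≤ v * ‖c - d‖) (hV1 : ∀ c, ‖V c‖ ≤ v * (1 + ‖c‖))
    (hy : ContinuousOn y (Icc a b)) (hB : 0 ≤ B)
    (hD : ∀ s t, a ≤ s → s ≤ t → t ≤ b →
      ‖y t - y s - V (y s) (x t - x s)‖ ≤ B * (t - s) ^ 2) :
    ∀ s t, a ≤ s → s ≤ t → t ≤ b →
      ‖y t - y s‖ ≤ 2 * (v + v ^ 2 / (1 - ρ)) * (1 + ‖y a‖) * ω s t ^ (1 / p) := by
  intro s t hs hst ht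
  have hp0 : 0 < p := by linarith
  have hq : 0 < 1 / p := by positivity
  have hab' : a ≤ b := hs.trans (hst.trans ht)
  obtain ⟨m, ⟨ham, hmb⟩, hm⟩ := isCompact_Icc.exists_isMaxOn (nonempty_Icc.2 hab') hy.norm
  have hmax : ∀ r, a ≤ r → r ≤ b → ‖y r‖ ≤ ‖y m‖ := fun r har hrb => hm ⟨har, hrb⟩
  have h1ρ : 0 < 1 - ρ := sub_pos.2 hρ1
  set K := v ^ 2 / (1 - ρ) with hK
  have hK0 : 0 ≤ K := by positivity
  have hM : 0 ≤ 1 + ‖y m‖ := by positivity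
  have hVM : ∀ r, a ≤ r → r ≤ b → ‖V (y r)‖ ≤ v * (1 + ‖y m‖) := fun r har hrb =>
    (hV1 _).trans (mul_le_mul_of_nonneg_left (by linarith [hmax r har hrb]) hv)
  have hR := remainder_bound_of_quadratic hp hv hM hl hρ hρ1 hω hωl hab hx hV hVM hB hD
  have hw0 : ∀ q r, a ≤ q → q ≤ r → r ≤ b → 0 ≤ ω q r ^ (1 / p) := fun q r haq hqr hrb =>
    Real.rpow_nonneg (hω.nonneg q r haq hqr hrb) _
  have hwl : ∀ q r, a ≤ q → q ≤ r → r ≤ b → ω q r ^ (1 / p) ≤ l := by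
    intro q r haq hqr hrb
    refine (Real.rpow_le_rpow (hω.nonneg q r haq hqr hrb)
      ((hω.mono haq hqr hrb).trans hωl.le) hq.le).trans (le_of_eq ?_)
    rw [← Real.rpow_mul hl, mul_one_div_cancel hp0.ne', Real.rpow_one]
  have hinc : ∀ q r, a ≤ q → q ≤ r → r ≤ b →
      ‖y r - y q‖ ≤ (v + K) * (1 + ‖y m‖) * ω q r ^ (1 / p) := by
    intro q r haq hqr hrb
    have hsq : (ω q r ^ (1 / p)) ^ 2 ≤ ω q r ^ (1 / p) :=
      pow_le_of_le_one (hw0 q r haq hqr hrb) ((hwl q r haq hqr hrb).trans hl1) two_ne_zero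
    calc ‖y r - y q‖ = ‖(y r - y q - V (y q) (x r - x q)) + V (y q) (x r - x q)‖ := by
          rw [sub_add_cancel]
      _ ≤ K * (1 + ‖y m‖) * (ω q r ^ (1 / p)) ^ 2 + v * (1 + ‖y m‖) * ω q r ^ (1 / p) :=
          (norm_add_le _ _).trans (add_le_add (hR q r haq hqr hrb)
            ((V (y q)).le_of_opNorm_le_of_le (hVM q haq (hqr.trans hrb)) (hx q r haq hqr hrb)))
      _ ≤ K * (1 + ‖y m‖) * ω q r ^ (1 / p) + v * (1 + ‖y m‖) * ω q r ^ (1 / p) :=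
          add_le_add_left (mul_le_mul_of_nonneg_left hsq (by positivity)) _
      _ = _ := by ring
  have hm2 : 1 + ‖y m‖ ≤ 2 * (1 + ‖y a‖) := by
    have h1 := hinc a m le_rfl ham hmb
    have h2 : (v + K) * (1 + ‖y m‖) * ω a m ^ (1 / p) ≤ (v + K) * (1 + ‖y m‖) * l :=
      mul_le_mul_of_nonneg_left (hwl a m le_rfl ham hmb) (by positivity)
    have h3 : (v + K) * l * (1 + ‖y m‖) ≤ 1 / 2 * (1 + ‖y m‖) :=
      mul_le_mul_of_nonneg_right hlK hM
    have h4 : ‖y m‖ ≤ ‖y a‖ + ‖y m - y a‖ := norm_le_norm_add_norm_sub' _ _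
    linarith
  refine (hinc s t hs hst ht).trans (mul_le_mul_of_nonneg_right ?_ (hw0 s t hs hst ht))
  have := mul_le_mul_of_nonneg_left hm2 (show 0 ≤ v + K by positivity)
  linarith

end Remainder

section Variation

variable {E F : Type*} [NormedAddCommGroup E] [NormedAddCommGroup F] {p : ℝ}
  {x : ℝ → E} {y : ℝ → F} {a b c : ℝ}

lemma oneVar_le_mul_of_norm_sub_le (hp : 1 ≤ p)
    (hfin : oneVarPow p x a b ≠ ⊤) (hc : 0 ≤ c)
    (h : ∀ s t, a ≤ s → s ≤ t → t ≤ b →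
      ‖y t - y s‖ ≤ c * (oneVarPow p x s t).toReal ^ (1 / p)) :
    oneVar p y a b ≤ ENNReal.ofReal (c * (oneVar p x a b).toReal) := by
  have hp0 : 0 < p := by linarith
  have hle : ∀ s t, a ≤ s → s ≤ t → t ≤ b → oneVarPow p x s t ≤ oneVarPow p x a b :=
    fun s t hs hst ht => (le_add_self.trans (oneVarPow_add_le p x hs hst)).trans
      (le_self_add.trans (oneVarPow_add_le p x (hs.trans hst) ht))
  rw [ENNReal.ofReal_mul hc, ENNReal.ofReal_toReal (oneVar_ne_top hp hfin)]
  refine (ENNReal.rpow_le_rpow_iff hp0).1 ?_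
  rw [ENNReal.mul_rpow_of_nonneg _ _ hp0.le, ← oneVarPow_eq_oneVar_rpow hp0,
    ← oneVarPow_eq_oneVar_rpow hp0]
  refine oneVarPow_le_of_superadditive
    (W := fun s t => ENNReal.ofReal c ^ p * oneVarPow p x s t) ?_ ?_
  · intro q r u _ hqr hru _
    rw [← mul_add]
    exact mul_le_mul_right (oneVarPow_add_le p x hqr hru) _
  · intro s t hs hst ht
    have hfin' := ne_top_of_le_ne_top hfin (hle s t hs hst ht)
    rw [oneVarPow_eq_oneVar_rpow hp0, ← ENNReal.mul_rpow_of_nonneg _ _ hp0.le]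
    refine ENNReal.rpow_le_rpow ?_ hp0.le
    rw [← ENNReal.ofReal_toReal (oneVar_ne_top hp hfin'), ← ENNReal.ofReal_mul hc,
      ← ENNReal.ofReal_coe_nnreal, oneVar, ← ENNReal.toReal_rpow]
    exact ENNReal.ofReal_le_ofReal (h s t hs hst ht)

/-- Patching: a bound on the variation over intervals of small control propagates to all
intervals, with geometric growth in the number of intervals needed. -/
lemma oneVar_le_geometric (hp : 1 ≤ p) {ω : ℝ → ℝ → ℝ} {η : ℝ} (hη : 0 ≤ η)
    (hω : IsControlOn ω a b)
    (hloc : ∀ s t, a ≤ s → s ≤ t → t ≤ b → ω s t ≤ η →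
      oneVar p y s t ≤ ENNReal.ofReal (1 + ‖y s‖)) (n : ℕ) :
    ∀ s t, a ≤ s → s ≤ t → t ≤ b → ω s t ≤ (n + 1) * η →
      oneVar p y s t ≤ ENNReal.ofReal ((1 + ‖y s‖) * (2 ^ (n + 1) - 1)) := by
  have hp0 : 0 < p := by linarith
  induction n with
  | zero =>
    intro s t hs hst ht h
    norm_num at h ⊢
    exact hloc s t hs hst ht h
  | succ n ih =>
    intro s t hs hst ht h
    have hpow : (1 : ℝ) ≤ 2 ^ (n + 1) := one_le_pow₀ one_le_two
    have hs0 : 0 ≤ 1 + ‖y s‖ := by positivity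
    rcases le_total (ω s t) η with hη' | hη'
    · refine (hloc s t hs hst ht hη').trans
        (ENNReal.ofReal_le_ofReal (le_mul_of_one_le_right hs0 ?_))
      rw [pow_succ]
      linarith
    obtain ⟨u, hsu, hut, hu1, hu2⟩ := hω.exists_split hs hst ht hη hη'
    have h1 := hloc s u hs hsu (hut.trans ht) hu1.le
    have h2 := ih u t (hs.trans hsu) hut ht (by push_cast at h; linarith)
    have hyu : ‖y u - y s‖ ≤ 1 + ‖y s‖ := by
      have h3 := nnnorm_sub_rpow_le_oneVarPow (p := p) (x := y) hsu
      rw [oneVarPow_eq_oneVar_rpow hp0, ENNReal.rpow_le_rpow_iff hp0] at h3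
      have h4 := h3.trans h1
      rw [← ENNReal.ofReal_coe_nnreal, ENNReal.ofReal_le_ofReal_iff hs0] at h4
      exact h4
    have hyu' : 1 + ‖y u‖ ≤ 2 * (1 + ‖y s‖) := by
      linarith [norm_le_norm_add_norm_sub' (y u) (y s)]
    refine (oneVar_le_add hp y hsu hut).trans ((add_le_add h1 h2).trans ?_)
    rw [← ENNReal.ofReal_add hs0 (mul_nonneg (by positivity) (by linarith))]
    refine ENNReal.ofReal_le_ofReal ?_
    have := mul_le_mul_of_nonneg_right hyu' (sub_nonneg.2 hpow)
    rw [pow_succ 2 (n + 1)]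
    linarith

end Variation

section Solution

variable {E F : Type*} [NormedAddCommGroup E] [NormedSpace ℝ E] [NormedAddCommGroup F]
  [NormedSpace ℝ F] {v : ℝ} {x : ℝ → E} {y : ℝ → F} {V : F → E →L[ℝ] F}

lemma exists_lipschitz_bound_of_contDiff (hx : ContDiff ℝ 1 x) (a b : ℝ) :
    ∃ L : ℝ, 0 ≤ L ∧ (∀ t, a ≤ t → t ≤ b → ‖deriv x t‖ ≤ L) ∧
      ∀ s t, a ≤ s → s ≤ t → t ≤ b → ‖x t - x s‖ ≤ L * (t - s) := by
  have hcont : Continuous (deriv x) := hx.continuous_deriv le_rfl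
  obtain ⟨L, hL⟩ := isCompact_Icc.exists_bound_of_continuousOn (s := Icc a b) hcont.continuousOn
  have hL' : ∀ t, a ≤ t → t ≤ b → ‖deriv x t‖ ≤ max L 0 := fun t h1 h2 =>
    (hL t ⟨h1, h2⟩).trans (le_max_left _ _)
  refine ⟨max L 0, le_max_right _ _, hL', fun s t hs hst ht => ?_⟩
  refine norm_image_sub_le_of_norm_deriv_le_segment' (f' := deriv x) (fun r _ =>
    ((hx.differentiable one_ne_zero) r).hasDerivAt.hasDerivWithinAt) (fun r hr => ?_) t
    ⟨hst, le_rfl⟩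
  exact hL' r (hs.trans hr.1) (hr.2.le.trans ht)

/-- The Euler remainder of a solution driven by a `C¹` path is quadratically small. -/
lemma exists_quadratic_remainder_bound (hv : 0 ≤ v) (hx : ContDiff ℝ 1 x)
    (hV : ∀ c d, ‖V c - V d‖ ≤ v * ‖c - d‖) (hV1 : ∀ c, ‖V c‖ ≤ v * (1 + ‖c‖)) {a b : ℝ}
    (hy : ∀ t ∈ Icc a b, HasDerivWithinAt y (V (y t) (deriv x t)) (Icc a b) t) :
    ∃ B : ℝ, 0 ≤ B ∧ ∀ s t, a ≤ s → s ≤ t → t ≤ b →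
      ‖y t - y s - V (y s) (x t - x s)‖ ≤ B * (t - s) ^ 2 := by
  obtain ⟨L, hL0, hL, -⟩ := exists_lipschitz_bound_of_contDiff hx a b
  have hyc : ContinuousOn y (Icc a b) := fun t ht => (hy t ht).continuousWithinAt
  obtain ⟨Y, hY⟩ := isCompact_Icc.exists_bound_of_continuousOn hyc
  have hY' : ∀ t ∈ Icc a b, ‖y t‖ ≤ |Y| := fun t ht => (hY t ht).trans (le_abs_self Y)
  have hder : ∀ s t, a ≤ s → t ≤ b → ∀ r ∈ Icc s t,
      HasDerivWithinAt y (V (y r) (deriv x r)) (Icc s t) r := fun s t hs ht r hr =>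
    (hy r (Icc_subset_Icc hs ht hr)).mono (Icc_subset_Icc hs ht)
  have hylip : ∀ s t, a ≤ s → s ≤ t → t ≤ b →
      ‖y t - y s‖ ≤ v * (1 + |Y|) * L * (t - s) := by
    intro s t hs hst ht
    refine norm_image_sub_le_of_norm_deriv_le_segment' (hder s t hs ht) (fun r hr => ?_) t
      ⟨hst, le_rfl⟩
    have hr' : r ∈ Icc a b := Icc_subset_Icc hs ht ⟨hr.1, hr.2.le⟩
    exact (V (y r)).le_of_opNorm_le_of_le ((hV1 _).trans
      (mul_le_mul_of_nonneg_left (by linarith [hY' r hr']) hv)) (hL r hr'.1 hr'.2)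
  refine ⟨v * (v * (1 + |Y|) * L) * L, by positivity, fun s t hs hst ht => ?_⟩
  have hg : ∀ r ∈ Icc s t, HasDerivWithinAt (fun r => y r - V (y s) (x r))
      (V (y r) (deriv x r) - V (y s) (deriv x r)) (Icc s t) r := fun r hr =>
    (hder s t hs ht r hr).sub ((V (y s)).hasFDerivAt.comp_hasDerivWithinAt r
      ((hx.differentiable one_ne_zero) r).hasDerivAt.hasDerivWithinAt)
  have h := norm_image_sub_le_of_norm_deriv_le_segment' hg
    (C := v * (v * (1 + |Y|) * L * (t - s)) * L) (fun r hr => ?_) t ⟨hst, le_rfl⟩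
  · have heq : y t - y s - V (y s) (x t - x s) =
        y t - V (y s) (x t) - (y s - V (y s) (x s)) := by
      rw [map_sub]
      abel
    rw [heq]
    refine h.trans (le_of_eq ?_)
    ring
  · rw [← sub_apply]
    have hrb : r ≤ b := hr.2.le.trans ht
    refine ContinuousLinearMap.le_of_opNorm_le_of_le _ ((hV _ _).trans
      (mul_le_mul_of_nonneg_left ?_ hv)) (hL r (hs.trans hr.1) hrb)
    refine (hylip s r hs hr.1 hrb).trans (mul_le_mul_of_nonneg_left ?_ (by positivity))
    linarith [hr.2]

end Solution

lemma half_rpow_one_div_sq_lt {p : ℝ} (hp1 : 1 ≤ p) (hp2 : p < 2) :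
    (((1 : ℝ) / 2) ^ (1 / p)) ^ 2 < 1 / 2 := by
  have hp0 : 0 < p := by linarith
  rw [← Real.rpow_natCast, ← Real.rpow_mul (by norm_num)]
  conv_rhs => rw [← Real.rpow_one ((1 : ℝ) / 2)]
  refine Real.rpow_lt_rpow_of_exponent_gt (by norm_num) (by norm_num) ?_
  rw [one_div_mul_eq_div, lt_div_iff₀ hp0]
  push_cast
  linarith

/-- For `1 ≤ p < 2` and `v > 0` there is a constant `C > 0`, depending
only on `p` and `v`, such that for every `C¹` driving path `x : [0,1] → ℝ^d`, every
`v`-Lipschitz vector field `V : ℝ^e → L(ℝ^d, ℝ^e)` of linear growth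
`‖V(a)‖ ≤ v·(1 + ‖a‖)`, and every solution `y` of `y′(t) = V(y(t))(x′(t))` on `[0,1]`,
one has `|y|_{p;[s,s']} ≤ (‖y(s)‖ + C·|x|_{p;[0,1]})·exp(C·|x|^p_{p;[s,s']})`
for all `0 ≤ s < s' ≤ 1`. -/
theorem cde_solution_variation_bound
    (p : ℝ) (hp1 : 1 ≤ p) (hp2 : p < 2) (v : ℝ) (hv : 0 < v) :
    ∃ C : ℝ, 0 < C ∧
      ∀ (d e : ℕ) (x : ℝ → EuclideanSpace ℝ (Fin d))
        (V : EuclideanSpace ℝ (Fin e) → (EuclideanSpace ℝ (Fin d) →L[ℝ] EuclideanSpace ℝ (Fin e)))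
        (y : ℝ → EuclideanSpace ℝ (Fin e)),
        ContDiff ℝ 1 x →
        (∀ a b, ‖V a - V b‖ ≤ v * ‖a - b‖) →
        (∀ a, ‖V a‖ ≤ v * (1 + ‖a‖)) →
        (∀ t ∈ Set.Icc (0:ℝ) 1,
          HasDerivWithinAt y (V (y t) (deriv x t)) (Set.Icc (0:ℝ) 1) t) →
        ∀ s s' : ℝ, 0 ≤ s → s < s' → s' ≤ 1 →
          oneVar p y s s' ≤
            ENNReal.ofReal ((‖y s‖ + C * (oneVar p x 0 1).toReal) *
              Real.exp (C * (oneVarPow p x s s').toReal)) := by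
  have hp0 : 0 < p := by linarith
  have hq : 0 < 1 / p := by positivity
  have hh := half_rpow_one_div_sq_lt hp1 hp2
  set h : ℝ := (((1 : ℝ) / 2) ^ (1 / p)) ^ 2 with hh_def
  have hh0 : 0 ≤ h := sq_nonneg _
  obtain ⟨K, hK⟩ : ∃ K, K = v + v ^ 2 / (1 - (h + 1 / 2)) := ⟨_, rfl⟩
  have hK0 : 0 < K := by
    have : 0 < 1 - (h + 1 / 2) := by linarith
    rw [hK]
    positivity
  obtain ⟨l, hl0, hl1, hlK, hlv⟩ :
      ∃ l : ℝ, 0 < l ∧ l ≤ 1 ∧ K * l ≤ 1 / 2 ∧ v * l ≤ 1 / 2 - h := by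
    refine ⟨min 1 (min (1 / 2 / K) ((1 / 2 - h) / v)), ?_, min_le_left _ _, ?_, ?_⟩
    · have : 0 < 1 / 2 - h := by linarith
      positivity
    · rw [mul_comm, ← le_div_iff₀ hK0]
      exact (min_le_right _ _).trans (min_le_left _ _)
    · rw [mul_comm, ← le_div_iff₀ hv]
      exact (min_le_right _ _).trans (min_le_right _ _)
  have hρ : (2 + v * l) * h ≤ h + 1 / 2 := by nlinarith [mul_pos hv hl0]
  have hlp : 0 < l ^ p := Real.rpow_pos_of_pos hl0 p
  set η : ℝ := l ^ p / 2 with hη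
  have hη0 : 0 < η := by positivity
  have hηq : 0 < η ^ (1 / p) := Real.rpow_pos_of_pos hη0 _
  refine ⟨2 * K + 1 / η ^ (1 / p) + 2 / η, by positivity, ?_⟩
  intro d e x V y hx hV hV1 hy s s' hs hss' hs'
  obtain ⟨L, -, -, hL⟩ := exists_lipschitz_bound_of_contDiff hx 0 1
  obtain ⟨B, hB, hD⟩ := exists_quadratic_remainder_bound hv.le hx hV hV1 hy
  have hω := isControlOn_oneVarPow hp1 hL
  have hfin : ∀ a b, 0 ≤ a → a ≤ b → b ≤ 1 → oneVarPow p x a b ≠ ⊤ := fun a b ha hab hb =>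
    oneVarPow_ne_top_of_lipschitz hp1 (fun q r hq hqr hr =>
      hL q r (ha.trans hq) hqr (hr.trans hb)) hab
  have hyc : ContinuousOn y (Set.Icc 0 1) := fun t ht => (hy t ht).continuousWithinAt
  have hlocal : ∀ a b, 0 ≤ a → a ≤ b → b ≤ 1 → (oneVarPow p x a b).toReal ≤ η →
      oneVar p y a b ≤ ENNReal.ofReal (2 * K * (1 + ‖y a‖) * (oneVar p x a b).toReal) := by
    intro a b ha hab hb hle
    refine oneVar_le_mul_of_norm_sub_le hp1 (hfin a b ha hab hb) (by positivity) ?_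
    rw [hK] at hlK ⊢
    exact increment_bound hp1 hv.le hl0.le hl1 hρ (by linarith) hlK (hω.subinterval ha hb)
      (hle.trans_lt (half_lt_self hlp)) (by linarith)
      (fun q r hq hqr hr => norm_sub_le_rpow_of_oneVarPow_ne_top hp0 hqr
        (hfin q r (ha.trans hq) hqr (hr.trans hb))) hV hV1
      (hyc.mono (Set.Icc_subset_Icc ha hb)) hB
      (fun q r hq hqr hr => hD q r (ha.trans hq) hqr (hr.trans hb))
  have htoReal : ∀ a b, (oneVar p x a b).toReal = (oneVarPow p x a b).toReal ^ (1 / p) :=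
    fun a b => by rw [oneVar, ENNReal.toReal_rpow]
  have hsmall : ∀ a b, (oneVarPow p x a b).toReal ≤ η → 2 * K * (oneVar p x a b).toReal ≤ 1 := by
    intro a b hle
    have h1 : (oneVar p x a b).toReal ≤ l := by
      rw [htoReal]
      refine (Real.rpow_le_rpow ENNReal.toReal_nonneg (hle.trans (half_le_self hlp.le))
        hq.le).trans (le_of_eq ?_)
      rw [← Real.rpow_mul hl0.le, mul_one_div_cancel hp0.ne', Real.rpow_one]
    linarith [mul_le_mul_of_nonneg_left h1 hK0.le]
  have hmono : (oneVar p x s s').toReal ≤ (oneVar p x 0 1).toReal := by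
    rw [htoReal, htoReal]
    exact Real.rpow_le_rpow ENNReal.toReal_nonneg (hω.mono hs hss'.le hs') hq.le
  set ω : ℝ := (oneVarPow p x s s').toReal with hωdef
  have hω0 : 0 ≤ ω := ENNReal.toReal_nonneg
  have hX0 : 0 ≤ (oneVar p x 0 1).toReal := ENNReal.toReal_nonneg
  set X : ℝ := (oneVar p x 0 1).toReal with hX
  have hηq' : 0 < 1 / η ^ (1 / p) := by positivity
  have hη2 : 0 < 2 / η := by positivity
  rcases le_total ω η with hle | hle
  · refine (hlocal s s' hs hss'.le hs' hle).trans (ENNReal.ofReal_le_ofReal ?_)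
    have h1 := mul_le_mul_of_nonneg_right (hsmall s s' hle) (norm_nonneg (y s))
    have h2 : 2 * K * (oneVar p x s s').toReal ≤ (2 * K + 1 / η ^ (1 / p) + 2 / η) * X :=
      mul_le_mul (by linarith) hmono ENNReal.toReal_nonneg (by positivity)
    have h3 : 2 * K * (1 + ‖y s‖) * (oneVar p x s s').toReal ≤
        ‖y s‖ + (2 * K + 1 / η ^ (1 / p) + 2 / η) * X := by linarith
    exact h3.trans (le_mul_of_one_le_right (by positivity) (Real.one_le_exp (by positivity)))
  · have hloc : ∀ a b, 0 ≤ a → a ≤ b → b ≤ 1 → (oneVarPow p x a b).toReal ≤ η →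
        oneVar p y a b ≤ ENNReal.ofReal (1 + ‖y a‖) := by
      intro a b ha hab hb hle
      refine (hlocal a b ha hab hb hle).trans (ENNReal.ofReal_le_ofReal ?_)
      have := mul_le_mul_of_nonneg_right (hsmall a b hle)
        (show 0 ≤ 1 + ‖y a‖ by positivity)
      linarith
    have hn : ω ≤ (⌊ω / η⌋₊ + 1) * η := by
      rw [← div_le_iff₀ hη0]
      exact (Nat.lt_floor_add_one _).le
    refine (oneVar_le_geometric hp1 hη0.le hω hloc ⌊ω / η⌋₊ s s' hs hss'.le hs' hn).trans
      (ENNReal.ofReal_le_ofReal ?_)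
    have hnle : (⌊ω / η⌋₊ : ℝ) + 1 ≤ 2 / η * ω := by
      have h1 := Nat.floor_le (show 0 ≤ ω / η by positivity)
      have h2 : 1 ≤ ω / η := (one_le_div hη0).2 hle
      have h3 : 2 / η * ω = ω / η + ω / η := by ring
      linarith
    have hpow : (2 : ℝ) ^ (⌊ω / η⌋₊ + 1) - 1 ≤
        Real.exp ((2 * K + 1 / η ^ (1 / p) + 2 / η) * ω) := by
      have h1 : (2 : ℝ) ≤ Real.exp 1 := by linarith [Real.add_one_le_exp (1 : ℝ)]
      have h2 : (2 : ℝ) ^ (⌊ω / η⌋₊ + 1) ≤ Real.exp (⌊ω / η⌋₊ + 1) := by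
        refine (pow_le_pow_left₀ zero_le_two h1 _).trans (le_of_eq ?_)
        rw [← Real.exp_nat_mul]
        push_cast
        ring_nf
      have h3 : 2 / η * ω ≤ (2 * K + 1 / η ^ (1 / p) + 2 / η) * ω :=
        mul_le_mul_of_nonneg_right (by linarith) hω0
      have h4 := Real.exp_le_exp.2 (hnle.trans h3)
      linarith
    have hbase : 1 + ‖y s‖ ≤ ‖y s‖ + (2 * K + 1 / η ^ (1 / p) + 2 / η) * X := by
      have h1 : η ^ (1 / p) ≤ X := by
        refine le_trans ?_ hmono
        rw [htoReal]
        exact Real.rpow_le_rpow hη0.le hle hq.le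
      have h2 : 1 ≤ 1 / η ^ (1 / p) * X := by
        rw [one_div_mul_eq_div]
        exact (one_le_div hηq).2 h1
      have h3 : 1 / η ^ (1 / p) * X ≤ (2 * K + 1 / η ^ (1 / p) + 2 / η) * X :=
        mul_le_mul_of_nonneg_right (by linarith) hX0
      linarith
    exact mul_le_mul hbase hpow (sub_nonneg.2 (one_le_pow₀ one_le_two)) (by positivity)
end

section
/- Let 1 ≤ p < q < ∞ and let X : [0,1]² → ℝ^d be continuous with finite controlled p-variation norm ‖X‖_{p-cvar} < ∞. Then X lies in the closure of smooth surfaces with respect to the controlled q-variation norm: for every ε > 0 there exists Y : [0,1]² → ℝ^d which is the restriction of a C^∞ function on ℝ² such that ‖X − Y‖_{q-cvar} ≤ ε. -/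
open scoped ENNReal

/-- A closed axis-parallel rectangle `[s,s']×[t,t']` in the plane. -/
structure Rect where
  s : ℝ
  s' : ℝ
  t : ℝ
  t' : ℝ

/-- The subset of the plane determined by a rectangle. -/
def Rect.toSet (r : Rect) : Set (ℝ × ℝ) := Set.Icc r.s r.s' ×ˢ Set.Icc r.t r.t'

/-- The unit square `[0,1]²`. -/
def unitRect : Rect := ⟨0, 1, 0, 1⟩

/-- The 2D increment `□_R[X] := X(s,t) − X(s',t) − X(s,t') + X(s',t')` of `X` over the
rectangle `R = [s,s']×[t,t']`. -/
def boxInc {E : Type*} [NormedAddCommGroup E] (X : ℝ → ℝ → E) (r : Rect) : E :=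
  X r.s r.t - X r.s' r.t - X r.s r.t' + X r.s' r.t'

/-- `π : Fin K → Rect` is a rectangle partition of `R`: a finite collection of closed
subrectangles with pairwise disjoint interiors whose union is `R`. -/
def IsRectPartition (R : Rect) {K : ℕ} (π : Fin K → Rect) : Prop :=
  (∀ i, (π i).s ≤ (π i).s' ∧ (π i).t ≤ (π i).t') ∧
  (∀ i j, i ≠ j → interior (π i).toSet ∩ interior (π j).toSet = ∅) ∧
  (⋃ i, (π i).toSet) = R.toSet

/-- The `p`-th power of the controlled 2D `p`-variation of `X` over the rectangle `R`:
the supremum over all rectangle partitions `π` of `R` of `∑_{r ∈ π} ‖□_r[X]‖^p`. -/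
noncomputable def cVarPow {E : Type*} [NormedAddCommGroup E]
    (p : ℝ) (X : ℝ → ℝ → E) (R : Rect) : ℝ≥0∞ :=
  ⨆ (K : ℕ) (π : Fin K → Rect) (_ : IsRectPartition R π),
    ∑ i, (‖boxInc X (π i)‖₊ : ℝ≥0∞) ^ p

/-- The controlled 2D `p`-variation `|X|_{p;R}`, i.e. the `1/p`-th power of `cVarPow`. -/
noncomputable def cVar {E : Type*} [NormedAddCommGroup E]
    (p : ℝ) (X : ℝ → ℝ → E) (R : Rect) : ℝ≥0∞ :=
  cVarPow p X R ^ (1 / p)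

/-- The `p`-th power of the grid 2D `p`-variation of `X` over the rectangle `R`:
the supremum over all grid-like partitions of `∑_{i,j} ‖□_{[σᵢ,σᵢ₊₁]×[τⱼ,τⱼ₊₁]}[X]‖^p`. -/
noncomputable def gridVarPow {E : Type*} [NormedAddCommGroup E]
    (p : ℝ) (X : ℝ → ℝ → E) (R : Rect) : ℝ≥0∞ :=
  ⨆ (n : ℕ) (m : ℕ) (σ : Fin (n + 1) → ℝ) (τ : Fin (m + 1) → ℝ)
    (_ : Monotone σ) (_ : Monotone τ)
    (_ : σ 0 = R.s) (_ : σ (Fin.last n) = R.s')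
    (_ : τ 0 = R.t) (_ : τ (Fin.last m) = R.t'),
    ∑ i : Fin n, ∑ j : Fin m,
      (‖boxInc X ⟨σ i.castSucc, σ i.succ, τ j.castSucc, τ j.succ⟩‖₊ : ℝ≥0∞) ^ p

/-- The grid 2D `p`-variation `V_p(X;R)`, i.e. the `1/p`-th power of `gridVarPow`. -/
noncomputable def gridVar {E : Type*} [NormedAddCommGroup E]
    (p : ℝ) (X : ℝ → ℝ → E) (R : Rect) : ℝ≥0∞ :=
  gridVarPow p X R ^ (1 / p)

/-- The supremum norm `sup_{[0,1]²} ‖X‖`, valued in `ℝ≥0∞`. -/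
noncomputable def supNormSq {E : Type*} [NormedAddCommGroup E] (X : ℝ → ℝ → E) : ℝ≥0∞ :=
  ⨆ (s ∈ Set.Icc (0:ℝ) 1) (t ∈ Set.Icc (0:ℝ) 1), (‖X s t‖₊ : ℝ≥0∞)

/-- The controlled `p`-variation norm
`‖X‖_{p-cvar} := sup ‖X‖ + |X(·,0)|_p + |X(0,·)|_p + |X|_{p;[0,1]²}`. -/
noncomputable def cvarNorm {E : Type*} [NormedAddCommGroup E]
    (p : ℝ) (X : ℝ → ℝ → E) : ℝ≥0∞ :=
  supNormSq X + oneVar p (fun s => X s 0) 0 1 + oneVar p (fun t => X 0 t) 0 1 +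
    cVar p X unitRect

/-- The `p`-variation norm
`‖X‖_{p-var} := sup ‖X‖ + |X(·,0)|_p + |X(0,·)|_p + V_p(X;[0,1]²)`. -/
noncomputable def varNorm {E : Type*} [NormedAddCommGroup E]
    (p : ℝ) (X : ℝ → ℝ → E) : ℝ≥0∞ :=
  supNormSq X + oneVar p (fun s => X s 0) 0 1 + oneVar p (fun t => X 0 t) 0 1 +
    gridVar p X unitRect

open MeasureTheory Set Filter Topology

section Variation

variable {E : Type*} [NormedAddCommGroup E]

/-! ### Elementary properties of the variation functionals -/

lemma sum_le_cVarPow {p : ℝ} {X : ℝ → ℝ → E} {R : Rect} {K : ℕ} {π : Fin K → Rect}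
    (h : IsRectPartition R π) :
    ∑ i, ‖boxInc X (π i)‖ₑ ^ p ≤ cVarPow p X R :=
  le_iSup_of_le K (le_iSup_of_le π (le_iSup_of_le h le_rfl))

lemma cVarPow_le {p : ℝ} {X : ℝ → ℝ → E} {R : Rect} {C : ℝ≥0∞}
    (h : ∀ (K : ℕ) (π : Fin K → Rect), IsRectPartition R π →
      ∑ i, ‖boxInc X (π i)‖ₑ ^ p ≤ C) : cVarPow p X R ≤ C :=
  iSup_le fun K => iSup_le fun π => iSup_le fun hπ => h K π hπ

lemma sum_le_oneVarPow {p : ℝ} {x : ℝ → E} {k : ℕ} {r : Fin (k + 1) → ℝ} (hr : Monotone r) :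
    ∑ i : Fin k, ‖x (r i.succ) - x (r i.castSucc)‖ₑ ^ p
      ≤ oneVarPow p x (r 0) (r (Fin.last k)) :=
  le_iSup_of_le k (le_iSup_of_le r (le_iSup_of_le hr
    (le_iSup_of_le rfl (le_iSup_of_le rfl le_rfl))))

lemma oneVarPow_le_s19 {p : ℝ} {x : ℝ → E} {s s' : ℝ} {C : ℝ≥0∞}
    (h : ∀ (k : ℕ) (r : Fin (k + 1) → ℝ), Monotone r → r 0 = s → r (Fin.last k) = s' →
      ∑ i : Fin k, ‖x (r i.succ) - x (r i.castSucc)‖ₑ ^ p ≤ C) : oneVarPow p x s s' ≤ C :=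
  iSup_le fun k => iSup_le fun r => iSup_le fun hr => iSup_le fun h0 => iSup_le fun h1 =>
    h k r hr h0 h1

lemma IsRectPartition.corners_mem {R : Rect} {K : ℕ} {π : Fin K → Rect}
    (h : IsRectPartition R π) (i : Fin K) :
    ((π i).s ∈ Icc R.s R.s' ∧ (π i).s' ∈ Icc R.s R.s') ∧
      ((π i).t ∈ Icc R.t R.t' ∧ (π i).t' ∈ Icc R.t R.t') := by
  have hsub : (π i).toSet ⊆ R.toSet := h.2.2 ▸ subset_iUnion (fun i => (π i).toSet) i
  obtain ⟨hs, ht⟩ := h.1 i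
  have h1 : ((π i).s, (π i).t) ∈ R.toSet := hsub ⟨⟨le_rfl, hs⟩, ⟨le_rfl, ht⟩⟩
  have h2 : ((π i).s', (π i).t') ∈ R.toSet := hsub ⟨⟨hs, le_rfl⟩, ⟨ht, le_rfl⟩⟩
  exact ⟨⟨h1.1, h2.1⟩, ⟨h1.2, h2.2⟩⟩

lemma cVarPow_congr {p : ℝ} {X Y : ℝ → ℝ → E} {R : Rect}
    (h : ∀ s ∈ Icc R.s R.s', ∀ t ∈ Icc R.t R.t', X s t = Y s t) :
    cVarPow p X R = cVarPow p Y R := by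
  refine iSup_congr fun K => iSup_congr fun π => iSup_congr fun hπ =>
    Finset.sum_congr rfl fun i _ => ?_
  obtain ⟨⟨h1, h2⟩, h3, h4⟩ := hπ.corners_mem i
  simp only [boxInc, h _ h1 _ h3, h _ h1 _ h4, h _ h2 _ h3, h _ h2 _ h4]

lemma oneVarPow_congr {p : ℝ} {x y : ℝ → E} {s s' : ℝ}
    (h : ∀ u ∈ Icc s s', x u = y u) : oneVarPow p x s s' = oneVarPow p y s s' := by
  refine iSup_congr fun k => iSup_congr fun r => iSup_congr fun hr => iSup_congr fun h0 =>
    iSup_congr fun h1 => Finset.sum_congr rfl fun i _ => ?_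
  have hm : ∀ j, r j ∈ Icc s s' := fun j =>
    ⟨h0 ▸ hr (Fin.zero_le j), h1 ▸ hr (Fin.le_last j)⟩
  rw [h _ (hm _), h _ (hm _)]

lemma cvarNorm_congr {p : ℝ} {X Y : ℝ → ℝ → E}
    (h : ∀ s ∈ Icc (0 : ℝ) 1, ∀ t ∈ Icc (0 : ℝ) 1, X s t = Y s t) :
    cvarNorm p X = cvarNorm p Y := by
  have h0 : (0 : ℝ) ∈ Icc (0 : ℝ) 1 := by simp
  have h1 : supNormSq X = supNormSq Y :=
    iSup_congr fun s => iSup_congr fun hs => iSup_congr fun t => iSup_congr fun ht => by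
      rw [h s hs t ht]
  simp only [cvarNorm, oneVar, cVar]
  rw [h1, oneVarPow_congr fun u hu => h u hu 0 h0, oneVarPow_congr fun u hu => h 0 h0 u hu,
    cVarPow_congr (R := unitRect) h]

/-! ### Transport of rectangle partitions -/

lemma IsRectPartition.map {R : Rect} {K : ℕ} {π : Fin K → Rect} (h : IsRectPartition R π)
    (H : ℝ × ℝ ≃ₜ ℝ × ℝ) (T : Rect → Rect) (hT : ∀ r, (T r).toSet = H '' r.toSet)
    (hle : ∀ r : Rect, r.s ≤ r.s' ∧ r.t ≤ r.t' → (T r).s ≤ (T r).s' ∧ (T r).t ≤ (T r).t') :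
    IsRectPartition (T R) (T ∘ π) := by
  refine ⟨fun i => hle _ (h.1 i), fun i j hij => ?_, ?_⟩
  · simp only [Function.comp, hT, ← H.image_interior]
    rw [← image_inter H.injective, h.2.1 i j hij, image_empty]
  · simp only [Function.comp, hT, ← image_iUnion, h.2.2]

lemma cVarPow_comp_affine {p : ℝ} {X : ℝ → ℝ → E} {c a b : ℝ} (hc : 0 < c) (R : Rect) :
    cVarPow p (fun s t => X (c * s + a) (c * t + b)) R ≤
      cVarPow p X ⟨c * R.s + a, c * R.s' + a, c * R.t + b, c * R.t' + b⟩ := by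
  refine cVarPow_le fun K π hπ => ?_
  let aff (e : ℝ) : ℝ ≃ₜ ℝ := (Homeomorph.mulLeft₀ c hc.ne').trans (Homeomorph.addRight e)
  let T : Rect → Rect := fun r => ⟨c * r.s + a, c * r.s' + a, c * r.t + b, c * r.t' + b⟩
  have hT : ∀ r : Rect, (T r).toSet = ((aff a).prodCongr (aff b)) '' r.toSet := fun r => by
    have : ⇑((aff a).prodCongr (aff b)) =
      Prod.map (fun x : ℝ => c * x + a) (fun x : ℝ => c * x + b) := by
      ext z <;> simp [aff]
    rw [this, Rect.toSet, Rect.toSet, prodMap_image_prod, image_affine_Icc' hc,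
      image_affine_Icc' hc]
  have key := hπ.map _ T hT fun r hr => by
    constructor
    · exact add_le_add_left (mul_le_mul_of_nonneg_left hr.1 hc.le) a
    · exact add_le_add_left (mul_le_mul_of_nonneg_left hr.2 hc.le) b
  have hle := sum_le_cVarPow (p := p) (X := X) key
  simpa only [boxInc, T, Function.comp_apply] using hle

lemma cVarPow_swap_le {p : ℝ} {X : ℝ → ℝ → E} (R : Rect) :
    cVarPow p (fun s t => X t s) R ≤ cVarPow p X ⟨R.t, R.t', R.s, R.s'⟩ := by
  refine cVarPow_le fun K π hπ => ?_
  let T : Rect → Rect := fun r => ⟨r.t, r.t', r.s, r.s'⟩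
  have key := hπ.map (Homeomorph.prodComm ℝ ℝ) T
    (fun r => (image_swap_prod (Icc r.s r.s') (Icc r.t r.t')).symm) fun r hr => ⟨hr.2, hr.1⟩
  refine le_trans (Finset.sum_le_sum fun i _ => ?_) (sum_le_cVarPow (X := X) key)
  refine le_of_eq (congrArg (fun v : E => ‖v‖ₑ ^ p) ?_)
  simp only [boxInc, T, Function.comp]
  abel

/-! ### Monotonicity in the domain -/

lemma cVarPow_le_of_union {p : ℝ} {X : ℝ → ℝ → E} {R₁ r R : Rect}
    (hr : r.s ≤ r.s' ∧ r.t ≤ r.t')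
    (hdisj : interior r.toSet ∩ interior R₁.toSet = ∅)
    (hunion : r.toSet ∪ R₁.toSet = R.toSet) : cVarPow p X R₁ ≤ cVarPow p X R := by
  refine cVarPow_le fun K π hπ => ?_
  have hsub : ∀ i, interior r.toSet ∩ interior (π i).toSet = ∅ := fun i =>
    subset_eq_empty (inter_subset_inter_right _ (interior_mono
      (hπ.2.2 ▸ subset_iUnion (fun i => (π i).toSet) i))) hdisj
  have key : IsRectPartition R (Fin.cons r π : Fin (K + 1) → Rect) := by
    refine ⟨fun i => ?_, fun i j hij => ?_, ?_⟩
    · refine Fin.cases ?_ (fun i => ?_) i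
      · simpa using hr
      · simpa using hπ.1 i
    · induction i using Fin.cases with
      | zero =>
        induction j using Fin.cases with
        | zero => exact absurd rfl hij
        | succ j => simpa using hsub j
      | succ i =>
        induction j using Fin.cases with
        | zero => simpa [inter_comm] using hsub i
        | succ j => simpa using hπ.2.1 i j fun h => hij (h ▸ rfl)
    · rw [← hunion, ← hπ.2.2]
      ext z
      simp [Fin.exists_fin_succ]
  refine le_trans ?_ (sum_le_cVarPow (X := X) key)
  rw [Fin.sum_univ_succ]
  simp

lemma Rect.interior_toSet (r : Rect) :
    interior r.toSet = Ioo r.s r.s' ×ˢ Ioo r.t r.t' := by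
  rw [Rect.toSet, interior_prod_eq, interior_Icc, interior_Icc]

lemma cVarPow_mono_left {p : ℝ} {X : ℝ → ℝ → E} {a₀ b₀ a b c d : ℝ}
    (ha : a₀ ≤ a) (hab : a ≤ b) (hb : b ≤ b₀) (hcd : c ≤ d) :
    cVarPow p X ⟨a, b, c, d⟩ ≤ cVarPow p X ⟨a₀, b₀, c, d⟩ := by
  trans cVarPow p X ⟨a₀, b, c, d⟩
  · refine cVarPow_le_of_union (r := ⟨a₀, a, c, d⟩) ⟨ha, hcd⟩ ?_ ?_
    · simp only [Rect.interior_toSet, prod_inter_prod, Ioo_inter_Ioo]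
      simp
    · simp only [Rect.toSet, ← union_prod, Icc_union_Icc_eq_Icc ha hab]
  · refine cVarPow_le_of_union (r := ⟨b, b₀, c, d⟩) ⟨hb, hcd⟩ ?_ ?_
    · simp only [Rect.interior_toSet, prod_inter_prod, Ioo_inter_Ioo]
      simp
    · simp only [Rect.toSet, ← union_prod, union_comm (Icc b b₀),
        Icc_union_Icc_eq_Icc (ha.trans hab) hb]

lemma cVarPow_mono {p : ℝ} {X : ℝ → ℝ → E} {R R' : Rect}
    (hs : R.s ≤ R.s') (ht : R.t ≤ R.t') (h₁ : R'.s ≤ R.s) (h₂ : R.s' ≤ R'.s')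
    (h₃ : R'.t ≤ R.t) (h₄ : R.t' ≤ R'.t') : cVarPow p X R ≤ cVarPow p X R' :=
  calc cVarPow p X R ≤ cVarPow p X ⟨R'.s, R'.s', R.t, R.t'⟩ := cVarPow_mono_left h₁ hs h₂ ht
    _ ≤ cVarPow p (fun s t => X t s) ⟨R.t, R.t', R'.s, R'.s'⟩ :=
      cVarPow_swap_le (X := fun s t => X t s) ⟨R'.s, R'.s', R.t, R.t'⟩
    _ ≤ cVarPow p (fun s t => X t s) ⟨R'.t, R'.t', R'.s, R'.s'⟩ :=
      cVarPow_mono_left h₃ ht h₄ (h₁.trans (hs.trans h₂))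
    _ ≤ cVarPow p X R' := cVarPow_swap_le _

lemma oneVarPow_mono_left {p : ℝ} {x : ℝ → E} {a₀ a b : ℝ} (ha : a₀ ≤ a) :
    oneVarPow p x a b ≤ oneVarPow p x a₀ b := by
  refine oneVarPow_le_s19 fun k r hr h0 h1 => ?_
  let r' : Fin (k + 2) → ℝ := Fin.cons a₀ r
  have hr' : Monotone r' := Fin.monotone_iff_le_succ.2 fun i => by
    induction i using Fin.cases with
    | zero => simpa [r', h0] using ha
    | succ i => simpa [r', ← Fin.succ_castSucc] using hr i.castSucc_le_succ
  have hlast : r' (Fin.last (k + 1)) = b := by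
    rw [← h1, ← Fin.succ_last]
    rfl
  have key := sum_le_oneVarPow (p := p) (x := x) hr'
  rw [hlast, Fin.sum_univ_succ] at key
  refine le_trans ?_ key
  simp [r']

lemma oneVarPow_mono_right {p : ℝ} {x : ℝ → E} {a b b₀ : ℝ} (hb : b ≤ b₀) :
    oneVarPow p x a b ≤ oneVarPow p x a b₀ := by
  refine oneVarPow_le_s19 fun k r hr h0 h1 => ?_
  let r' : Fin (k + 2) → ℝ := Fin.snoc r b₀
  have hcast : ∀ i : Fin (k + 1), r' i.castSucc = r i := fun i => by simp [r']
  have hlast : r' (Fin.last (k + 1)) = b₀ := by simp [r']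
  have hr' : Monotone r' := Fin.monotone_iff_le_succ.2 fun i => by
    induction i using Fin.lastCases with
    | last => rw [hcast, Fin.succ_last, hlast, h1]; exact hb
    | cast i => rw [hcast, Fin.succ_castSucc, hcast]; exact hr i.castSucc_le_succ
  have hzero : r' 0 = a := by rw [← h0, ← hcast]; rfl
  have key := sum_le_oneVarPow (p := p) (x := x) hr'
  rw [hlast, hzero, Fin.sum_univ_castSucc] at key
  refine le_trans ?_ key
  simp only [hcast, Fin.succ_castSucc]
  exact le_self_add

lemma oneVarPow_comp_affine {p : ℝ} {x : ℝ → E} {c e a b : ℝ} (hc : 0 ≤ c) :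
    oneVarPow p (fun s => x (c * s + e)) a b ≤ oneVarPow p x (c * a + e) (c * b + e) := by
  refine oneVarPow_le_s19 fun k r hr h0 h1 => ?_
  have hr' : Monotone fun i => c * r i + e := fun i j hij =>
    add_le_add_left (mul_le_mul_of_nonneg_left (hr hij) hc) e
  have key := sum_le_oneVarPow (p := p) (x := x) hr'
  rwa [h0, h1] at key

/-! ### Variation of the sections of a surface -/

lemma iUnion_Icc_of_monotone {k : ℕ} {r : Fin (k + 1) → ℝ} (hr : Monotone r) (hk : k ≠ 0) :
    (⋃ i : Fin k, Icc (r i.castSucc) (r i.succ)) = Icc (r 0) (r (Fin.last k)) := by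
  refine Subset.antisymm (iUnion_subset fun i =>
    Icc_subset_Icc (hr (Fin.zero_le _)) (hr (Fin.le_last _))) fun x hx => ?_
  by_contra hnot
  simp only [mem_iUnion, mem_Icc, not_exists, not_and, not_le] at hnot
  have key : ∀ i : Fin (k + 1), r i ≤ x := fun i => by
    induction i using Fin.induction with
    | zero => exact hx.1
    | succ i ih => exact (hnot i ih).le
  obtain ⟨m, rfl⟩ := Nat.exists_eq_succ_of_ne_zero hk
  exact absurd hx.2 (not_le.2 (hnot (Fin.last m) (key _)))

lemma sum_strips_le_cVarPow {p : ℝ} {X : ℝ → ℝ → E} {k : ℕ} {r : Fin (k + 1) → ℝ}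
    (hr : Monotone r) {t t' : ℝ} (ht : t ≤ t') :
    ∑ i : Fin k, ‖boxInc X ⟨r i.castSucc, r i.succ, t, t'⟩‖ₑ ^ p
      ≤ cVarPow p X ⟨r 0, r (Fin.last k), t, t'⟩ := by
  rcases eq_or_ne k 0 with rfl | hk
  · simp
  refine sum_le_cVarPow (X := X) (π := fun i : Fin k => ⟨r i.castSucc, r i.succ, t, t'⟩)
    ⟨fun i => ⟨hr i.castSucc_le_succ, ht⟩, fun i j hij => ?_, ?_⟩
  · have hlt : ∀ i j : Fin k, i < j → min (r i.succ) (r j.succ)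
        ≤ max (r i.castSucc) (r j.castSucc) := fun i j h =>
      (min_le_left _ _).trans ((hr (Fin.succ_le_castSucc_iff.2 h)).trans (le_max_right _ _))
    simp only [Rect.interior_toSet, prod_inter_prod, Ioo_inter_Ioo]
    rw [Ioo_eq_empty, empty_prod]
    rw [not_lt]
    rcases lt_or_gt_of_ne hij with h | h
    · exact hlt i j h
    · simpa only [min_comm, max_comm] using hlt j i h
  · simp only [Rect.toSet]
    rw [← iUnion_prod_const, iUnion_Icc_of_monotone hr hk]

lemma sum_rpow_enorm_add_le {ι : Type*} (S : Finset ι) {p : ℝ} (hp : 1 ≤ p) (a b : ι → E) :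
    ∑ i ∈ S, ‖a i + b i‖ₑ ^ p ≤
      2 ^ (p - 1) * (∑ i ∈ S, ‖a i‖ₑ ^ p + ∑ i ∈ S, ‖b i‖ₑ ^ p) := by
  rw [← Finset.sum_add_distrib, Finset.mul_sum]
  exact Finset.sum_le_sum fun i _ =>
    (ENNReal.rpow_le_rpow (enorm_add_le _ _) (zero_le_one.trans hp)).trans
      (ENNReal.rpow_add_le_mul_rpow_add_rpow _ _ hp)

lemma oneVarPow_section_le {p : ℝ} (hp : 1 ≤ p) {X : ℝ → ℝ → E} {a b t₀ t : ℝ} (ht : t₀ ≤ t) :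
    oneVarPow p (fun s => X s t) a b ≤
      2 ^ (p - 1) * (oneVarPow p (fun s => X s t₀) a b + cVarPow p X ⟨a, b, t₀, t⟩) := by
  refine oneVarPow_le_s19 fun k r hr h0 h1 => ?_
  have hsplit : ∀ i : Fin k, X (r i.succ) t - X (r i.castSucc) t =
      (X (r i.succ) t₀ - X (r i.castSucc) t₀) +
        boxInc X ⟨r i.castSucc, r i.succ, t₀, t⟩ := fun i => by
    simp only [boxInc]
    abel
  simp only [hsplit]
  refine (sum_rpow_enorm_add_le _ hp _ _).trans ?_
  subst h0 h1
  gcongr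
  · exact sum_le_oneVarPow (x := fun s => X s t₀) hr
  · exact sum_strips_le_cVarPow hr ht

lemma oneVarPow_affine_section_le {p : ℝ} (hp : 1 ≤ p) {X : ℝ → ℝ → E} {c e t : ℝ}
    (hc : 0 ≤ c) (he : 0 ≤ e) (hce : c + e ≤ 1) (ht : t ∈ Icc (0 : ℝ) 1) :
    oneVarPow p (fun s => X (c * s + e) t) 0 1 ≤
      2 ^ (p - 1) * (oneVarPow p (fun s => X s 0) 0 1 + cVarPow p X unitRect) :=
  calc oneVarPow p (fun s => X (c * s + e) t) 0 1
      ≤ oneVarPow p (fun s => X s t) (c * 0 + e) (c * 1 + e) :=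
        oneVarPow_comp_affine (x := fun s => X s t) hc
    _ ≤ oneVarPow p (fun s => X s t) 0 1 :=
        (oneVarPow_mono_left (by simpa using he)).trans (oneVarPow_mono_right (by simpa using hce))
    _ ≤ _ := oneVarPow_section_le hp ht.1
    _ ≤ _ := by
        gcongr
        exact cVarPow_mono zero_le_one ht.1 le_rfl le_rfl le_rfl ht.2

/-! ### Averages and interpolation -/

lemma rpow_enorm_integral_le [NormedSpace ℝ E] {Ω : Type*} [MeasurableSpace Ω] {μ : Measure Ω}
    [IsProbabilityMeasure μ] {p : ℝ} (hp : 1 ≤ p) {f : Ω → E} (hf : AEStronglyMeasurable f μ) :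
    ‖∫ ω, f ω ∂μ‖ₑ ^ p ≤ ∫⁻ ω, ‖f ω‖ₑ ^ p ∂μ := by
  have hp0 : 0 < p := zero_lt_one.trans_le hp
  have h := eLpNorm'_le_eLpNorm'_of_exponent_le zero_lt_one hp μ hf
  simp only [eLpNorm', ENNReal.rpow_one, div_one] at h
  calc ‖∫ ω, f ω ∂μ‖ₑ ^ p ≤ ((∫⁻ ω, ‖f ω‖ₑ ^ p ∂μ) ^ (1 / p)) ^ p :=
        ENNReal.rpow_le_rpow ((enorm_integral_le_lintegral_enorm f).trans h) hp0.le
    _ = _ := by rw [← ENNReal.rpow_mul, one_div_mul_cancel hp0.ne', ENNReal.rpow_one]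

lemma sum_rpow_enorm_integral_le [NormedSpace ℝ E] {Ω ι : Type*} [MeasurableSpace Ω]
    {μ : Measure Ω} [IsProbabilityMeasure μ] {p : ℝ} (hp : 1 ≤ p) (S : Finset ι)
    {f : ι → Ω → E} (hf : ∀ i, AEStronglyMeasurable (f i) μ) {C : ℝ≥0∞}
    (hC : ∀ᵐ ω ∂μ, ∑ i ∈ S, ‖f i ω‖ₑ ^ p ≤ C) :
    ∑ i ∈ S, ‖∫ ω, f i ω ∂μ‖ₑ ^ p ≤ C :=
  calc ∑ i ∈ S, ‖∫ ω, f i ω ∂μ‖ₑ ^ p ≤ ∑ i ∈ S, ∫⁻ ω, ‖f i ω‖ₑ ^ p ∂μ :=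
        Finset.sum_le_sum fun i _ => rpow_enorm_integral_le hp (hf i)
    _ = ∫⁻ ω, ∑ i ∈ S, ‖f i ω‖ₑ ^ p ∂μ :=
        (lintegral_finsetSum' _ fun i _ => (hf i).enorm.pow_const p).symm
    _ ≤ ∫⁻ _, C ∂μ := lintegral_mono_ae hC
    _ = C := by simp

lemma cVarPow_integral_le [NormedSpace ℝ E] {Ω : Type*} [MeasurableSpace Ω] {μ : Measure Ω}
    [IsProbabilityMeasure μ] {p : ℝ} (hp : 1 ≤ p) {F : Ω → ℝ → ℝ → E}
    (hF : ∀ s t, Integrable (fun ω => F ω s t) μ) {R : Rect} {C : ℝ≥0∞}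
    (hC : ∀ᵐ ω ∂μ, cVarPow p (F ω) R ≤ C) :
    cVarPow p (fun s t => ∫ ω, F ω s t ∂μ) R ≤ C := by
  refine cVarPow_le fun K π hπ => ?_
  have hint : ∀ i, Integrable (fun ω => boxInc (F ω) (π i)) μ := fun i =>
    (((hF _ _).sub (hF _ _)).sub (hF _ _)).add (hF _ _)
  have heq : ∀ i, boxInc (fun s t => ∫ ω, F ω s t ∂μ) (π i) = ∫ ω, boxInc (F ω) (π i) ∂μ := by
    intro i
    simp only [boxInc]
    rw [integral_add ?_ (hF _ _), integral_sub ?_ (hF _ _), integral_sub (hF _ _) (hF _ _)]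
    · exact (hF _ _).sub (hF _ _)
    · exact ((hF _ _).sub (hF _ _)).sub (hF _ _)
  simp only [heq]
  exact sum_rpow_enorm_integral_le hp _ (fun i => (hint i).aestronglyMeasurable)
    (hC.mono fun ω hω => (sum_le_cVarPow hπ).trans hω)

lemma oneVarPow_integral_le [NormedSpace ℝ E] {Ω : Type*} [MeasurableSpace Ω] {μ : Measure Ω}
    [IsProbabilityMeasure μ] {p : ℝ} (hp : 1 ≤ p) {f : Ω → ℝ → E}
    (hf : ∀ s, Integrable (fun ω => f ω s) μ) {a b : ℝ} {C : ℝ≥0∞}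
    (hC : ∀ᵐ ω ∂μ, oneVarPow p (f ω) a b ≤ C) :
    oneVarPow p (fun s => ∫ ω, f ω s ∂μ) a b ≤ C := by
  refine oneVarPow_le_s19 fun k r hr h0 h1 => ?_
  subst h0 h1
  simp only [← integral_sub (hf _) (hf _)]
  exact sum_rpow_enorm_integral_le hp _ (fun i => ((hf _).sub (hf _)).aestronglyMeasurable)
    (hC.mono fun ω hω => (sum_le_oneVarPow hr).trans hω)

lemma sum_rpow_enorm_le_of_le {ι : Type*} (S : Finset ι) {p q : ℝ} (hp : 0 ≤ p) (hpq : p ≤ q)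
    {a : ι → E} {η : ℝ≥0∞} (ha : ∀ i, ‖a i‖ₑ ≤ η) :
    ∑ i ∈ S, ‖a i‖ₑ ^ q ≤ η ^ (q - p) * ∑ i ∈ S, ‖a i‖ₑ ^ p := by
  rw [Finset.mul_sum]
  refine Finset.sum_le_sum fun i _ => ?_
  calc ‖a i‖ₑ ^ q = ‖a i‖ₑ ^ (q - p) * ‖a i‖ₑ ^ p := by
        rw [← ENNReal.rpow_add_of_nonneg _ _ (sub_nonneg.2 hpq) hp, sub_add_cancel]
    _ ≤ _ := by gcongr; exact ha i

lemma cVarPow_sub_le {p q : ℝ} (hp : 1 ≤ p) (hpq : p ≤ q) {X Y : ℝ → ℝ → E} {R : Rect}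
    {η : ℝ≥0∞}
    (h : ∀ s ∈ Icc R.s R.s', ∀ t ∈ Icc R.t R.t', ‖X s t - Y s t‖ₑ ≤ η) :
    cVarPow q (fun s t => X s t - Y s t) R ≤
      (4 * η) ^ (q - p) * (2 ^ (p - 1) * (cVarPow p X R + cVarPow p Y R)) := by
  refine cVarPow_le fun K π hπ => ?_
  have hbound : ∀ i, ‖boxInc (fun s t => X s t - Y s t) (π i)‖ₑ ≤ 4 * η := fun i => by
    obtain ⟨⟨h1, h2⟩, h3, h4⟩ := hπ.corners_mem i
    calc _ ≤ η + η + η + η := (enorm_add_le _ _).trans (add_le_add ((enorm_sub_le).trans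
          (add_le_add ((enorm_sub_le).trans (add_le_add (h _ h1 _ h3) (h _ h2 _ h3)))
            (h _ h1 _ h4))) (h _ h2 _ h4))
      _ = 4 * η := by ring
  refine (sum_rpow_enorm_le_of_le _ (zero_le_one.trans hp) hpq hbound).trans ?_
  gcongr
  have hsplit : ∀ i, boxInc (fun s t => X s t - Y s t) (π i) =
      boxInc X (π i) + -boxInc Y (π i) := fun i => by
    simp only [boxInc]
    abel
  simp only [hsplit]
  refine (sum_rpow_enorm_add_le _ hp _ _).trans ?_
  simp only [enorm_neg]
  gcongr
  exacts [sum_le_cVarPow hπ, sum_le_cVarPow hπ]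

lemma oneVarPow_sub_le {p q : ℝ} (hp : 1 ≤ p) (hpq : p ≤ q) {x y : ℝ → E} {a b : ℝ} {η : ℝ≥0∞}
    (h : ∀ s ∈ Icc a b, ‖x s - y s‖ₑ ≤ η) :
    oneVarPow q (fun s => x s - y s) a b ≤
      (4 * η) ^ (q - p) * (2 ^ (p - 1) * (oneVarPow p x a b + oneVarPow p y a b)) := by
  refine oneVarPow_le_s19 fun k r hr h0 h1 => ?_
  subst h0 h1
  have hm : ∀ j, r j ∈ Icc (r 0) (r (Fin.last k)) := fun j =>
    ⟨hr (Fin.zero_le j), hr (Fin.le_last j)⟩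
  have hbound : ∀ i : Fin k, ‖(x (r i.succ) - y (r i.succ)) -
      (x (r i.castSucc) - y (r i.castSucc))‖ₑ ≤ 4 * η := fun i =>
    calc _ ≤ η + η := enorm_sub_le.trans (add_le_add (h _ (hm _)) (h _ (hm _)))
      _ = 2 * η := (two_mul η).symm
      _ ≤ 4 * η := by gcongr; norm_num
  refine (sum_rpow_enorm_le_of_le _ (zero_le_one.trans hp) hpq hbound).trans ?_
  gcongr
  have hsplit : ∀ i : Fin k, (x (r i.succ) - y (r i.succ)) - (x (r i.castSucc) -
      y (r i.castSucc)) = (x (r i.succ) - x (r i.castSucc)) +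
        -(y (r i.succ) - y (r i.castSucc)) := fun i => by abel
  simp only [hsplit]
  refine (sum_rpow_enorm_add_le _ hp _ _).trans ?_
  simp only [enorm_neg]
  gcongr
  exacts [sum_le_oneVarPow hr, sum_le_oneVarPow hr]

/-- Interpolation: a uniformly small difference of two surfaces of bounded controlled
`p`-variation is small in controlled `q`-variation. -/
lemma cvarNorm_sub_le {p q : ℝ} (hp : 1 ≤ p) (hpq : p ≤ q) {X Y : ℝ → ℝ → E} {η K : ℝ≥0∞}
    (h : ∀ s ∈ Icc (0 : ℝ) 1, ∀ t ∈ Icc (0 : ℝ) 1, ‖X s t - Y s t‖ₑ ≤ η)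
    (h₁ : oneVarPow p (fun s => X s 0) 0 1 + oneVarPow p (fun s => Y s 0) 0 1 ≤ K)
    (h₂ : oneVarPow p (fun t => X 0 t) 0 1 + oneVarPow p (fun t => Y 0 t) 0 1 ≤ K)
    (h₃ : cVarPow p X unitRect + cVarPow p Y unitRect ≤ K) :
    cvarNorm q (fun s t => X s t - Y s t) ≤
      η + 3 * ((4 * η) ^ (q - p) * (2 ^ (p - 1) * K)) ^ (1 / q) := by
  have h0 : (0 : ℝ) ∈ Icc (0 : ℝ) 1 := by simp
  have hq : 0 ≤ 1 / q := by
    have : 0 ≤ q := by linarith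
    positivity
  have hsup : supNormSq (fun s t => X s t - Y s t) ≤ η :=
    iSup₂_le fun s hs => iSup₂_le fun t ht => h s hs t ht
  rw [show ∀ z : ℝ≥0∞, η + 3 * z = η + z + z + z from fun z => by ring]
  refine add_le_add (add_le_add (add_le_add hsup ?_) ?_) ?_ <;>
    refine ENNReal.rpow_le_rpow ?_ hq
  · refine (oneVarPow_sub_le hp hpq fun s hs => h s hs 0 h0).trans ?_
    gcongr
  · refine (oneVarPow_sub_le hp hpq fun t ht => h 0 h0 t ht).trans ?_
    gcongr
  · refine (cVarPow_sub_le hp hpq (R := unitRect) h).trans ?_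
    gcongr

/-! ### Mollification -/

/-- Averaging a bounded continuous function against a smooth compactly supported density. -/
lemma exists_measure_contDiff_average [NormedSpace ℝ E] {X : ℝ × ℝ → E} (hX : Continuous X)
    {δ : ℝ} (hδ : 0 < δ) :
    ∃ μ : Measure (ℝ × ℝ), IsProbabilityMeasure μ ∧ (∀ᵐ u ∂μ, ‖u‖ < δ) ∧
      ContDiff ℝ (⊤ : ℕ∞) fun z => ∫ u, X (z - u) ∂μ := by
  let φ : ContDiffBump (0 : ℝ × ℝ) := ⟨δ / 2, δ, by positivity, by linarith⟩
  let ρ : ℝ × ℝ → ℝ := φ.normed volume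
  have hρ0 : ∀ u, 0 ≤ ρ u := φ.nonneg_normed
  have hmeas : Measurable fun u => ENNReal.ofReal (ρ u) :=
    φ.continuous_normed.measurable.ennreal_ofReal
  refine ⟨volume.withDensity fun u => ENNReal.ofReal (ρ u), ⟨?_⟩, ?_, ?_⟩
  · rw [withDensity_apply _ MeasurableSet.univ, Measure.restrict_univ,
      ← ofReal_integral_eq_lintegral_ofReal φ.integrable_normed (ae_of_all _ hρ0),
      φ.integral_normed, ENNReal.ofReal_one]
  · rw [ae_withDensity_iff hmeas]
    refine ae_of_all _ fun u hu => ?_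
    have : u ∈ Function.support (φ.normed volume) := fun h => hu (by simp [ρ, h])
    rw [φ.support_normed_eq] at this
    simpa using this
  · have heq : (fun z => ∫ u, X (z - u) ∂(volume.withDensity fun u => ENNReal.ofReal (ρ u))) =
        convolution ρ X (ContinuousLinearMap.lsmul ℝ ℝ) volume := by
      funext z
      rw [integral_withDensity_eq_integral_toReal_smul hmeas (by simp), convolution_def]
      simp [ENNReal.toReal_ofReal (hρ0 _)]
    rw [heq]
    exact φ.hasCompactSupport_normed.contDiff_convolution_left _ φ.contDiff_normed
      hX.locallyIntegrable

/-- A bounded uniformly continuous surface is uniformly approximated on the unit square by smooth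
surfaces whose `p`-variations are controlled by those of the given surface. -/
lemma exists_contDiff_near [NormedSpace ℝ E] [CompleteSpace E] {p : ℝ} (hp : 1 ≤ p) {X : ℝ → ℝ → E}
    (hX : UniformContinuous fun z : ℝ × ℝ => X z.1 z.2) {B : ℝ} (hB : ∀ s t, ‖X s t‖ ≤ B)
    {η : ℝ} (hη : 0 < η) :
    ∃ Y : ℝ → ℝ → E, ContDiff ℝ (⊤ : ℕ∞) (fun z : ℝ × ℝ => Y z.1 z.2) ∧
      (∀ s ∈ Icc (0 : ℝ) 1, ∀ t ∈ Icc (0 : ℝ) 1, ‖X s t - Y s t‖ ≤ η) ∧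
      oneVarPow p (fun s => Y s 0) 0 1 ≤
        2 ^ (p - 1) * (oneVarPow p (fun s => X s 0) 0 1 + cVarPow p X unitRect) ∧
      oneVarPow p (fun t => Y 0 t) 0 1 ≤
        2 ^ (p - 1) * (oneVarPow p (fun t => X 0 t) 0 1 + cVarPow p X unitRect) ∧
      cVarPow p Y unitRect ≤ cVarPow p X unitRect := by
  obtain ⟨δ₀, hδ₀, hunif⟩ := Metric.uniformContinuous_iff.1 hX η hη
  obtain ⟨δ, hδ, hδ4, hδ2⟩ : ∃ δ : ℝ, 0 < δ ∧ δ ≤ 1 / 4 ∧ 2 * δ < δ₀ :=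
    ⟨min (1 / 4) (δ₀ / 4), by positivity, min_le_left _ _, by
      linarith [min_le_right (1 / 4) (δ₀ / 4)]⟩
  obtain ⟨μ, hμ, hsupp, hsmooth⟩ := exists_measure_contDiff_average hX.continuous hδ
  have hu : ∀ᵐ u ∂μ, (-δ < u.1 ∧ u.1 < δ) ∧ (-δ < u.2 ∧ u.2 < δ) := hsupp.mono fun u hu => by
    rw [Prod.norm_def, max_lt_iff, Real.norm_eq_abs, Real.norm_eq_abs, abs_lt, abs_lt] at hu
    exact hu
  let c : ℝ := 1 - 2 * δ
  have hc : 0 < c := by simp only [c]; linarith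
  let F : ℝ × ℝ → ℝ → ℝ → E := fun u s t => X (c * s + (δ - u.1)) (c * t + (δ - u.2))
  have hF : ∀ s t, Integrable (fun u => F u s t) μ := fun s t => by
    refine Integrable.of_bound (Continuous.aestronglyMeasurable ?_) B
      (ae_of_all _ fun u => hB _ _)
    exact hX.continuous.comp (f := fun u : ℝ × ℝ => (c * s + (δ - u.1), c * t + (δ - u.2)))
      (by fun_prop)
  refine ⟨fun s t => ∫ u, F u s t ∂μ, ?_, fun s hs t ht => ?_, ?_, ?_, ?_⟩
  · have := hsmooth.comp (g := fun z : ℝ × ℝ => ∫ u, X (z - u).1 (z - u).2 ∂μ)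
      (f := fun z : ℝ × ℝ => (c * z.1 + δ, c * z.2 + δ)) (by fun_prop)
    simpa [F, Function.comp_def, add_sub_assoc] using this
  · have hsub : X s t - ∫ u, F u s t ∂μ = ∫ u, (X s t - F u s t) ∂μ := by
      rw [integral_sub (integrable_const _) (hF s t)]
      simp
    have hclose : ∀ᵐ u ∂μ, ‖X s t - F u s t‖ ≤ η := hu.mono fun u hu => by
      rw [← dist_eq_norm]
      refine (hunif (a := (s, t)) (b := (c * s + (δ - u.1), c * t + (δ - u.2))) ?_).le
      rw [Prod.dist_eq, max_lt_iff, Real.dist_eq, Real.dist_eq, abs_lt, abs_lt]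
      simp only [c]
      obtain ⟨⟨h1, h2⟩, h3, h4⟩ := hu
      obtain ⟨hs0, hs1⟩ := hs
      obtain ⟨ht0, ht1⟩ := ht
      refine ⟨⟨?_, ?_⟩, ?_, ?_⟩ <;> nlinarith
    rw [hsub]
    simpa using norm_integral_le_of_norm_le_const hclose
  · refine oneVarPow_integral_le hp (fun s => hF s 0) (hu.mono fun u hu => ?_)
    exact oneVarPow_affine_section_le hp hc.le (by linarith) (by simp only [c]; linarith)
      ⟨by linarith, by linarith⟩
  · refine oneVarPow_integral_le hp (fun t => hF 0 t) (hu.mono fun u hu => ?_)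
    refine (oneVarPow_affine_section_le (X := fun s t => X t s) hp hc.le (by linarith)
      (by simp only [c]; linarith) ⟨by linarith, by linarith⟩).trans ?_
    gcongr
    exact cVarPow_swap_le unitRect
  · refine cVarPow_integral_le hp hF (hu.mono fun u hu => ?_)
    refine (cVarPow_comp_affine hc unitRect).trans ?_
    refine cVarPow_mono ?_ ?_ ?_ ?_ ?_ ?_ <;> simp only [unitRect, c] <;> linarith

lemma ne_top_of_cvarNorm_ne_top {p : ℝ} (hp : 0 < p) {X : ℝ → ℝ → E} (h : cvarNorm p X ≠ ⊤) :
    oneVarPow p (fun s => X s 0) 0 1 ≠ ⊤ ∧ oneVarPow p (fun t => X 0 t) 0 1 ≠ ⊤ ∧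
      cVarPow p X unitRect ≠ ⊤ := by
  have hpow : ∀ {z : ℝ≥0∞}, z ^ (1 / p) ≠ ⊤ → z ≠ ⊤ := fun hz h => hz (by simp [h, hp])
  simp only [cvarNorm, ENNReal.add_ne_top, oneVar, cVar] at h
  exact ⟨hpow h.1.1.2, hpow h.1.2, hpow h.2⟩

lemma exists_uniformContinuous_extension {X : ℝ → ℝ → E}
    (hX : ContinuousOn (fun z : ℝ × ℝ => X z.1 z.2) (Icc 0 1 ×ˢ Icc 0 1)) :
    ∃ W : ℝ → ℝ → E, UniformContinuous (fun z : ℝ × ℝ => W z.1 z.2) ∧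
      (∃ B : ℝ, ∀ s t, ‖W s t‖ ≤ B) ∧
      ∀ s ∈ Icc (0 : ℝ) 1, ∀ t ∈ Icc (0 : ℝ) 1, W s t = X s t := by
  let P : ℝ → ℝ := fun s => projIcc (0 : ℝ) 1 zero_le_one s
  have hP : ∀ s, P s ∈ Icc (0 : ℝ) 1 := fun s => (projIcc (0 : ℝ) 1 zero_le_one s).2
  have hPu : UniformContinuous P :=
    uniformContinuous_subtype_val.comp (LipschitzWith.projIcc zero_le_one).uniformContinuous
  have hcomp : IsCompact (Icc (0 : ℝ) 1 ×ˢ Icc (0 : ℝ) 1) := isCompact_Icc.prod isCompact_Icc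
  refine ⟨fun s t => X (P s) (P t), ?_, ?_, fun s hs t ht => ?_⟩
  · rw [← uniformContinuousOn_univ]
    exact (hcomp.uniformContinuousOn_of_continuous hX).comp
      (hPu.prodMap hPu).uniformContinuousOn fun z _ => ⟨hP z.1, hP z.2⟩
  · obtain ⟨B, hB⟩ := hcomp.exists_bound_of_continuousOn hX
    exact ⟨B, fun s t => hB (P s, P t) ⟨hP s, hP t⟩⟩
  · simp only [P, projIcc_of_mem zero_le_one hs, projIcc_of_mem zero_le_one ht]

end Variation

/-- If `1 ≤ p < q` and `X : [0,1]² → ℝ^d` is continuous with finite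
controlled `p`-variation norm, then `X` lies in the closure of smooth surfaces in the
controlled `q`-variation norm: for every `ε > 0` there is a surface `Y` that is the
restriction of a `C^∞` function on `ℝ²` with `‖X − Y‖_{q-cvar} ≤ ε`. -/
theorem mem_closure_smooth_in_controlled_qvar
    (d : ℕ) (p q : ℝ) (hp : 1 ≤ p) (hpq : p < q)
    (X : ℝ → ℝ → EuclideanSpace ℝ (Fin d))
    (hcont : ContinuousOn (fun z : ℝ × ℝ => X z.1 z.2) (Set.Icc 0 1 ×ˢ Set.Icc 0 1))
    (hfin : cvarNorm p X ≠ ⊤) :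
    ∀ ε : ℝ, 0 < ε → ∃ Y : ℝ → ℝ → EuclideanSpace ℝ (Fin d),
      ContDiff ℝ (⊤ : ℕ∞) (fun z : ℝ × ℝ => Y z.1 z.2) ∧
      cvarNorm q (fun s t => X s t - Y s t) ≤ ENNReal.ofReal ε := by
  intro ε hε
  obtain ⟨W, hW, ⟨B, hB⟩, hWX⟩ := exists_uniformContinuous_extension hcont
  rw [← cvarNorm_congr hWX] at hfin
  obtain ⟨h₁, h₂, h₃⟩ := ne_top_of_cvarNorm_ne_top (zero_lt_one.trans_le hp) hfin
  set v₁ := oneVarPow p (fun s => W s 0) 0 1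
  set v₂ := oneVarPow p (fun t => W 0 t) 0 1
  set v₃ := cVarPow p W unitRect
  let K : ℝ≥0∞ := v₁ + v₂ + v₃ + 2 ^ (p - 1) * (v₁ + v₂ + v₃)
  have htwo : (2 : ℝ≥0∞) ^ (p - 1) ≠ ⊤ :=
    ENNReal.rpow_ne_top_of_nonneg (sub_nonneg.2 hp) ENNReal.ofNat_ne_top
  have hsum : v₁ + v₂ + v₃ ≠ ⊤ := by simp [h₁, h₂, h₃]
  have hK : 2 ^ (p - 1) * K ≠ ⊤ :=
    ENNReal.mul_ne_top htwo (ENNReal.add_ne_top.2 ⟨hsum, ENNReal.mul_ne_top htwo hsum⟩)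
  have hq : 0 < q := by linarith
  have hlim : Tendsto (fun η : ℝ => ENNReal.ofReal η +
      3 * ((4 * ENNReal.ofReal η) ^ (q - p) * (2 ^ (p - 1) * K)) ^ (1 / q))
      (𝓝[>] 0) (𝓝 0) := by
    have h0 : Tendsto ENNReal.ofReal (𝓝[>] 0) (𝓝 0) := by
      simpa using (ENNReal.continuous_ofReal.tendsto 0).mono_left nhdsWithin_le_nhds
    have h4 : Tendsto (fun η => 4 * ENNReal.ofReal η) (𝓝[>] 0) (𝓝 0) := by
      simpa using ENNReal.Tendsto.const_mul h0 (Or.inr ENNReal.ofNat_ne_top)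
    have h5 := ENNReal.Tendsto.mul_const (h4.ennrpow_const (q - p)) (Or.inr hK)
    have h6 := ENNReal.Tendsto.const_mul (h5.ennrpow_const (1 / q))
      (Or.inr (ENNReal.ofNat_ne_top (n := 3)))
    simpa [ENNReal.zero_rpow_of_pos (sub_pos.2 hpq), hq] using h0.add h6
  obtain ⟨η, hηε, hη⟩ := ((hlim.eventually_lt_const (ENNReal.ofReal_pos.2 hε)).and
    self_mem_nhdsWithin).exists
  obtain ⟨Y, hY, hclose, hY₁, hY₂, hY₃⟩ := exists_contDiff_near hp hW hB (mem_Ioi.1 hη)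
  refine ⟨Y, hY, ?_⟩
  rw [← cvarNorm_congr (X := fun s t => W s t - Y s t) fun s hs t ht => by rw [hWX s hs t ht]]
  have hone : (1 : ℝ≥0∞) ≤ 2 ^ (p - 1) :=
    ENNReal.rpow_zero (x := 2) ▸
      ENNReal.rpow_le_rpow_of_exponent_le (by norm_num) (sub_nonneg.2 hp)
  refine (cvarNorm_sub_le (K := K) hp hpq.le (fun s hs t ht => ?_) ?_ ?_ ?_).trans hηε.le
  · rw [← ofReal_norm]
    exact ENNReal.ofReal_le_ofReal (hclose s hs t ht)
  · refine add_le_add ?_ (hY₁.trans ?_)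
    · exact le_self_add.trans le_self_add
    · gcongr
      exact le_self_add
  · refine add_le_add ?_ (hY₂.trans ?_)
    · exact le_add_self.trans le_self_add
    · gcongr
      exact le_add_self
  · refine add_le_add le_add_self (hY₃.trans ?_)
    exact (le_add_self).trans (le_mul_of_one_le_left' hone)
end
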